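/- Let p ≡ 5 (mod 8) be prime with 2 a primitive root modulo p, and ζ ∈ F_{2^{p-1}} a primitive p-th root of unity. Then 3 divides (2^{(p-1)/2}-1)/ord(ζ+ζ⁻¹) if and only if ε_p ≡ 1 (mod 2O_K) or 3 divides h_p. -/

import Mathlib

open NumberField

section IdealCount

variable (K : Type*) [Field K] [NumberField K]

/-- The number of integral ideals of norm `n`, as an arithmetic function. -/
noncomputable def idealCount : ArithmeticFunction ℕ where
  toFun n := if n = 0 then 0 else Nat.card {I : Ideal (𝓞 K) // Ideal.absNorm I = n}
  map_zero' := if_pos rfl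

variable {K}

theorem idealCount_apply {n : ℕ} (hn : n ≠ 0) :
    idealCount K n = Nat.card {I : Ideal (𝓞 K) // Ideal.absNorm I = n} := if_neg hn

theorem ideal_dvd_span_natCast {I : Ideal (𝓞 K)} {n : ℕ} (hI : Ideal.absNorm I = n) :
    I ∣ Ideal.span {(n : 𝓞 K)} := by
  rw [Ideal.dvd_span_singleton, ← hI]
  exact Ideal.absNorm_mem I

theorem isCoprime_span_natCast {R : Type*} [CommRing R] {a b : ℕ} (hab : a.Coprime b) :
    IsCoprime (Ideal.span {(a : R)}) (Ideal.span {(b : R)}) := by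
  rw [Ideal.isCoprime_span_singleton_iff]
  simpa using (Nat.isCoprime_iff_coprime.mpr hab).map (Int.castRingHom R)

theorem absNorm_span_natCast (hdeg : Module.finrank ℚ K = 2) (n : ℕ) :
    Ideal.absNorm (Ideal.span {(n : 𝓞 K)}) = n ^ 2 := by
  rw [Ideal.absNorm_span_singleton]
  have := Algebra.norm_algebraMap (R := ℤ) (S := 𝓞 K) (n : ℤ)
  rw [RingOfIntegers.rank, hdeg] at this
  simp only [eq_intCast, Int.cast_natCast] at this
  rw [this]
  simp [Int.natAbs_pow]

/-- Multiplication of ideals of coprime norms is a bijection. -/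
theorem bijective_mul_of_coprime {a b : ℕ} (hab : a.Coprime b) :
    Function.Bijective (fun P : {I : Ideal (𝓞 K) // Ideal.absNorm I = a} ×
        {I : Ideal (𝓞 K) // Ideal.absNorm I = b} ↦
      (⟨P.1 * P.2, by rw [map_mul, P.1.2, P.2.2]⟩ :
        {I : Ideal (𝓞 K) // Ideal.absNorm I = a * b})) := by
  have hc := isCoprime_span_natCast (R := 𝓞 K) hab
  constructor
  · rintro ⟨⟨I₁, h₁⟩, J₁, k₁⟩ ⟨⟨I₂, h₂⟩, J₂, k₂⟩ h
    simp only [Subtype.mk.injEq] at h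
    have hc' {I J : Ideal (𝓞 K)} (hI : Ideal.absNorm I = a) (hJ : Ideal.absNorm J = b) :
        IsCoprime I J :=
      (hc.of_isCoprime_of_dvd_left (ideal_dvd_span_natCast hI)).of_isCoprime_of_dvd_right
        (ideal_dvd_span_natCast hJ)
    have e₁ : I₁ = I₂ := dvd_antisymm ((hc' h₁ k₂).dvd_of_dvd_mul_right (h ▸ dvd_mul_right _ _))
      ((hc' h₂ k₁).dvd_of_dvd_mul_right (h ▸ dvd_mul_right _ _))
    have e₂ : J₁ = J₂ := dvd_antisymm
      ((hc' h₂ k₁).symm.dvd_of_dvd_mul_left (h ▸ dvd_mul_left _ _))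
      ((hc' h₁ k₂).symm.dvd_of_dvd_mul_left (h ▸ dvd_mul_left _ _))
    subst e₁ e₂
    rfl
  · rintro ⟨I, hI⟩
    have hdvd := ideal_dvd_span_natCast hI
    rw [Nat.cast_mul, ← Ideal.span_singleton_mul_span_singleton] at hdvd
    obtain ⟨A, B, hA, hB, rfl⟩ := exists_dvd_and_dvd_of_dvd_mul hdvd
    rw [map_mul] at hI
    have hcop {n : ℕ} {J : Ideal (𝓞 K)} (hJ : J ∣ Ideal.span {(n : 𝓞 K)}) :
        ∃ k, Ideal.absNorm J ∣ n ^ k := by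
      refine ⟨Module.finrank ℤ (𝓞 K), ?_⟩
      have := map_dvd Ideal.absNorm hJ
      rw [Ideal.absNorm_span_singleton] at this
      have h2 := Algebra.norm_algebraMap (R := ℤ) (S := 𝓞 K) (n : ℤ)
      simp only [eq_intCast, Int.cast_natCast] at h2
      simpa [h2, Int.natAbs_pow] using this
    obtain ⟨k, hk⟩ := hcop hA
    obtain ⟨l, hl⟩ := hcop hB
    have hAb : (Ideal.absNorm A).Coprime b := (hab.pow_left k).coprime_dvd_left hk
    have hBa : (Ideal.absNorm B).Coprime a := (hab.symm.pow_left l).coprime_dvd_left hl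
    have hAa : Ideal.absNorm A = a := Nat.dvd_antisymm
      (hAb.dvd_of_dvd_mul_right (hI ▸ dvd_mul_right _ _))
      (hBa.symm.dvd_of_dvd_mul_right (hI ▸ dvd_mul_right _ _))
    have hBb : Ideal.absNorm B = b := Nat.dvd_antisymm
      (hBa.dvd_of_dvd_mul_left (hI ▸ dvd_mul_left _ _))
      (hAb.symm.dvd_of_dvd_mul_left (hI ▸ dvd_mul_left _ _))
    exact ⟨⟨⟨A, hAa⟩, B, hBb⟩, rfl⟩

theorem isMultiplicative_idealCount : (idealCount K).IsMultiplicative := by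
  rw [ArithmeticFunction.IsMultiplicative.iff_ne_zero]
  refine ⟨?_, fun {m n} hm hn hmn ↦ ?_⟩
  · rw [idealCount_apply one_ne_zero]
    simp [Ideal.absNorm_eq_one_iff]
  · rw [idealCount_apply hm, idealCount_apply hn, idealCount_apply (mul_ne_zero hm hn),
      ← Nat.card_prod]
    exact (Nat.card_congr (Equiv.ofBijective _ (bijective_mul_of_coprime hmn))).symm

theorem idealCount_prime_pow_of_inert (hdeg : Module.finrank ℚ K = 2) {q : ℕ} (hq : q.Prime)
    (hP : Prime (Ideal.span {(q : 𝓞 K)})) (k : ℕ) :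
    idealCount K (q ^ k) = if Even k then 1 else 0 := by
  rw [idealCount_apply (pow_ne_zero _ hq.ne_zero)]
  have key {I : Ideal (𝓞 K)} (hI : Ideal.absNorm I = q ^ k) :
      ∃ i, k = 2 * i ∧ I = Ideal.span {(q : 𝓞 K)} ^ i := by
    have := ideal_dvd_span_natCast hI
    rw [Nat.cast_pow, ← Ideal.span_singleton_pow, dvd_prime_pow hP] at this
    obtain ⟨i, -, hi⟩ := this
    rw [associated_iff_eq] at hi
    refine ⟨i, ?_, hi⟩
    rw [hi, map_pow, absNorm_span_natCast hdeg, ← pow_mul] at hI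
    exact (Nat.pow_right_injective hq.two_le hI).symm
  split_ifs with hk
  · obtain ⟨i, rfl⟩ := hk
    rw [Nat.card_eq_one_iff_exists]
    refine ⟨⟨Ideal.span {(q : 𝓞 K)} ^ i, ?_⟩, fun ⟨I, hI⟩ ↦ ?_⟩
    · rw [map_pow, absNorm_span_natCast hdeg, ← pow_mul, two_mul]
    · obtain ⟨j, hj, rfl⟩ := key hI
      obtain rfl : i = j := by lia
      rfl
  · have : IsEmpty {I : Ideal (𝓞 K) // Ideal.absNorm I = q ^ k} :=
      ⟨fun ⟨I, hI⟩ ↦ hk (by obtain ⟨i, rfl, -⟩ := key hI; exact even_two_mul i)⟩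
    exact Nat.card_of_isEmpty

theorem idealCount_prime_pow_of_ramified {q : ℕ} (hq : q.Prime) {P : Ideal (𝓞 K)} (hP : Prime P)
    (hPq : Ideal.absNorm P = q) (hPP : P ^ 2 = Ideal.span {(q : 𝓞 K)}) (k : ℕ) :
    idealCount K (q ^ k) = 1 := by
  rw [idealCount_apply (pow_ne_zero _ hq.ne_zero), Nat.card_eq_one_iff_exists]
  refine ⟨⟨P ^ k, by rw [map_pow, hPq]⟩, fun ⟨I, hI⟩ ↦ ?_⟩
  have := ideal_dvd_span_natCast hI
  rw [Nat.cast_pow, ← Ideal.span_singleton_pow, ← hPP, ← pow_mul, dvd_prime_pow hP] at this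
  obtain ⟨i, -, hi⟩ := this
  rw [associated_iff_eq] at hi
  subst hi
  rw [map_pow, hPq] at hI
  exact Subtype.ext (congrArg (P ^ ·) (Nat.pow_right_injective hq.two_le hI))

theorem idealCount_prime_pow_of_split {q : ℕ} (hq : q.Prime) {P Q : Ideal (𝓞 K)} (hP : Prime P)
    (hQ : Prime Q) (hne : P ≠ Q) (hPq : Ideal.absNorm P = q) (hQq : Ideal.absNorm Q = q)
    (hPQ : P * Q = Ideal.span {(q : 𝓞 K)}) (k : ℕ) :
    idealCount K (q ^ k) = k + 1 := by
  rw [idealCount_apply (pow_ne_zero _ hq.ne_zero), ← Nat.card_fin (k + 1)]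
  have hnd : ¬ P ∣ Q := fun h ↦ hne (associated_iff_eq.mp (hP.associated_of_dvd hQ h))
  have inj {i j i' j' : ℕ} (h : P ^ i * Q ^ j = P ^ i' * Q ^ j') : i' ≤ i := by
    by_contra! hlt
    obtain ⟨d, rfl⟩ := Nat.exists_eq_add_of_lt hlt
    rw [add_assoc, pow_add, mul_assoc] at h
    have h' := mul_left_cancel₀ (pow_ne_zero _ hP.ne_zero) h
    refine hnd (hP.dvd_of_dvd_pow (n := j) ?_)
    rw [h', pow_succ', mul_assoc]
    exact dvd_mul_right _ _
  refine (Nat.card_congr (Equiv.ofBijective (fun i : Fin (k + 1) ↦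
    (⟨P ^ (i : ℕ) * Q ^ (k - i), ?_⟩ : {I : Ideal (𝓞 K) // Ideal.absNorm I = q ^ k})) ?_)).symm
  · rw [map_mul, map_pow, map_pow, hPq, hQq, ← pow_add]
    congr 1
    lia
  · constructor
    · intro i i' h
      simp only [Subtype.mk.injEq] at h
      exact Fin.ext (le_antisymm (inj h.symm) (inj h))
    · rintro ⟨I, hI⟩
      have := ideal_dvd_span_natCast hI
      rw [Nat.cast_pow, ← Ideal.span_singleton_pow, ← hPQ, mul_pow] at this
      obtain ⟨A, B, hA, hB, rfl⟩ := exists_dvd_and_dvd_of_dvd_mul this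
      obtain ⟨i, -, hi⟩ := (dvd_prime_pow hP _).mp hA
      obtain ⟨j, -, hj⟩ := (dvd_prime_pow hQ _).mp hB
      rw [associated_iff_eq] at hi hj
      subst hi hj
      rw [map_mul, map_pow, map_pow, hPq, hQq, ← pow_add] at hI
      have := Nat.pow_right_injective hq.two_le hI
      refine ⟨⟨i, by lia⟩, ?_⟩
      simp only [Subtype.mk.injEq]
      congr 2
      lia

end IdealCount

section QuadraticRing

theorem QuadraticAlgebra.algebraTrace_eq {R : Type*} [CommRing R] {a b : R}
    (z : QuadraticAlgebra R a b) : Algebra.trace R (QuadraticAlgebra R a b) z = z.trace := by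
  rw [Algebra.trace_eq_matrix_trace (QuadraticAlgebra.basis a b), Matrix.trace_fin_two,
    Algebra.leftMulMatrix_eq_repr_mul, Algebra.leftMulMatrix_eq_repr_mul]
  simp [QuadraticAlgebra.basis, QuadraticAlgebra.linearEquivTuple, QuadraticAlgebra.equivProd,
    QuadraticAlgebra.trace_def]
  ring

theorem QuadraticAlgebra.discr_basis {R : Type*} [CommRing R] (a b : R) :
    Algebra.discr R (QuadraticAlgebra.basis a b) = b ^ 2 + 4 * a := by
  rw [Algebra.discr_def, Matrix.det_fin_two]
  simp only [Algebra.traceMatrix_apply, Algebra.traceForm_apply, QuadraticAlgebra.algebraTrace_eq]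
  simp [QuadraticAlgebra.basis, QuadraticAlgebra.linearEquivTuple, QuadraticAlgebra.trace_def]
  ring

theorem Int.exists_eq_of_prime_mul_sq {p : ℕ} (hp : p.Prime) {w : ℚ} {m : ℤ}
    (h : p * w ^ 2 = m) : ∃ b : ℤ, w = b := by
  have hp0 : (p : ℚ) ≠ 0 := mod_cast hp.ne_zero
  obtain ⟨t, ht⟩ : ∃ t : ℤ, (t : ℚ) = p * w := by
    refine IsIntegrallyClosed.isIntegral_iff.mp (IsIntegral.of_pow (n := 2) two_pos ?_)
    rw [show (p * w) ^ 2 = ((p * m : ℤ) : ℚ) by push_cast; rw [← h]; ring]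
    exact isIntegral_algebraMap (R := ℤ) (A := ℚ)
  have htm : t ^ 2 = p * m := by
    have : (t : ℚ) ^ 2 = p * m := by rw [ht, ← h]; ring
    exact_mod_cast this
  obtain ⟨b, rfl⟩ := (Nat.prime_iff_prime_int.mp hp).dvd_of_dvd_pow (htm ▸ dvd_mul_right _ _)
  refine ⟨b, ?_⟩
  push_cast at ht
  exact (mul_left_cancel₀ hp0 ht).symm

theorem exists_eq_add_mul {K : Type*} [Field K] [CharZero K] {p : ℕ} (hp : p.Prime) {α : K}
    (hα : α ^ 2 = p) (hdeg : Module.finrank ℚ K = 2) :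
    ∃ σ : K →+* K, σ α = -α ∧ (∀ x y : ℚ, (x : K) + y * α = 0 → y = 0) ∧
      ∀ x : K, ∃ u v : ℚ, x = u + v * α := by
  have hne (r : ℚ) : (r : K) ≠ α := by
    intro h
    rw [← h] at hα
    have h2 : r ^ 2 = p := mod_cast hα
    obtain ⟨n, rfl⟩ := Int.exists_eq_of_prime_mul_sq (m := p ^ 2) hp (w := r)
      (by rw [h2]; push_cast; ring)
    have h3 : n ^ 2 = p := mod_cast h2
    exact (Nat.prime_iff_prime_int.mp hp).irreducible.not_isSquare ⟨n, by rw [← h3]; ring⟩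
  have hindep : ∀ x y : ℚ, (x : K) + y * α = 0 → y = 0 := by
    intro x y h
    by_contra hy
    refine hne (-x / y) ?_
    have : (y : K) ≠ 0 := mod_cast hy
    push_cast
    field_simp
    linear_combination -h
  let f : QuadraticAlgebra ℚ (p : ℚ) 0 →ₐ[ℚ] K :=
    QuadraticAlgebra.lift ⟨α, by
      rw [← pow_two, hα, zero_smul, add_zero, Algebra.smul_def, mul_one]; simp⟩
  have hf (z : QuadraticAlgebra ℚ (p : ℚ) 0) : f z = z.re + z.im * α := by
    simp [f, QuadraticAlgebra.lift, Algebra.smul_def]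
  have hinj : Function.Injective f := by
    rw [injective_iff_map_eq_zero]
    intro z hz
    rw [hf] at hz
    have him := hindep _ _ hz
    rw [him] at hz
    ext
    · simpa using hz
    · simpa using him
  have : FiniteDimensional ℚ K := Module.finite_of_finrank_pos (by lia)
  have hsurj : Function.Surjective f := by
    have := LinearMap.injective_iff_surjective_of_finrank_eq_finrank (f := f.toLinearMap)
      (by rw [hdeg, QuadraticAlgebra.finrank_eq_two])
    exact this.mp hinj
  let e : QuadraticAlgebra ℚ (p : ℚ) 0 ≃+* K := RingEquiv.ofBijective f ⟨hinj, hsurj⟩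
  have he : e QuadraticAlgebra.omega = α := by
    change f _ = _
    simp [hf]
  refine ⟨(e : _ →+* K).comp ((starRingEnd _).comp (e.symm : K →+* QuadraticAlgebra ℚ (p : ℚ) 0)),
    ?_, hindep, fun x ↦ ?_⟩
  · have : e.symm α = QuadraticAlgebra.omega := by rw [← he, e.symm_apply_apply]
    simp only [RingHom.comp_apply, RingHom.coe_coe, this, starRingEnd_apply]
    change f _ = _
    simp [hf]
  · obtain ⟨z, rfl⟩ := hsurj x
    exact ⟨z.re, z.im, hf z⟩

theorem exists_algEquiv_ringOfIntegers {K : Type*} [Field K] [CharZero K] {p : ℕ} (hp : p.Prime)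
    {c : ℤ} (hc : (p : ℤ) = 4 * c + 1) {α : K} (hα : α ^ 2 = p)
    (hdeg : Module.finrank ℚ K = 2) :
    ∃ e : QuadraticAlgebra ℤ c 1 ≃ₐ[ℤ] 𝓞 K,
      ∀ z, 2 * ((e z : 𝓞 K) : K) = 2 * z.re + z.im * (1 + α) := by
  obtain ⟨σ, hσα, hindep, hspan⟩ := exists_eq_add_mul hp hα hdeg
  have hcK : (p : K) = 4 * c + 1 := mod_cast congrArg (Int.cast : ℤ → K) hc
  have hω : ((1 + α) / 2) * ((1 + α) / 2) = (c : K) + (1 + α) / 2 := by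
    linear_combination (hα + hcK) / 4
  have hint : IsIntegral ℤ ((1 + α) / 2) := by
    refine ⟨Polynomial.X ^ 2 - Polynomial.X - Polynomial.C c, by monicity!, ?_⟩
    rw [Polynomial.eval₂_sub, Polynomial.eval₂_sub, Polynomial.eval₂_X_pow, Polynomial.eval₂_X,
      Polynomial.eval₂_C, algebraMap_int_eq, eq_intCast]
    linear_combination hω
  let w : 𝓞 K := ⟨(1 + α) / 2, hint⟩
  have hw : (w : K) = (1 + α) / 2 := rfl
  let f : QuadraticAlgebra ℤ c 1 →ₐ[ℤ] 𝓞 K := QuadraticAlgebra.lift ⟨w, by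
    apply RingOfIntegers.ext
    change (w : K) * (w : K) = algebraMap (𝓞 K) K (c • 1 + (1 : ℤ) • w)
    rw [map_add, map_zsmul, map_zsmul, map_one, hw, hω]
    simp [hw]⟩
  have hf (z : QuadraticAlgebra ℤ c 1) : ((f z : 𝓞 K) : K) = z.re + z.im * ((1 + α) / 2) := by
    simp [f, hw, QuadraticAlgebra.lift]
  have hinj : Function.Injective f := by
    rw [injective_iff_map_eq_zero]
    intro z hz
    have h0 : ((f z : 𝓞 K) : K) = 0 := by rw [hz]; rfl
    rw [hf] at h0
    have him := hindep (z.re + z.im / 2) (z.im / 2) (by push_cast; linear_combination h0)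
    have him' : z.im = 0 := by
      have : (z.im : ℚ) = 0 := by linarith
      exact_mod_cast this
    rw [him'] at h0
    ext
    · simpa using h0
    · simpa using him'
  have hsurj : Function.Surjective f := by
    intro x
    obtain ⟨u, v, huv⟩ := hspan x
    have hx : IsIntegral ℤ (x : K) := x.2
    have hσx : IsIntegral ℤ (σ x) := hx.map σ.toIntAlgHom
    have hσx' : σ x = u - v * α := by rw [huv]; simp [hσα]; ring
    have desc {r : ℚ} (h : IsIntegral ℤ (r : K)) : ∃ n : ℤ, r = n := by
      have h' : IsIntegral ℤ r :=
        (isIntegral_algHom_iff (Algebra.ofId ℚ K |>.restrictScalars ℤ)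
          (algebraMap ℚ K).injective).mp (by simpa using h)
      obtain ⟨n, hn⟩ := IsIntegrallyClosed.isIntegral_iff.mp h'
      exact ⟨n, by simpa using hn.symm⟩
    obtain ⟨a, ha⟩ := desc (r := 2 * u) (by
      have := hx.add hσx
      rwa [show (x : K) + σ x = ((2 * u : ℚ) : K) by rw [hσx', huv]; push_cast; ring] at this)
    obtain ⟨N, hN⟩ := desc (r := u ^ 2 - p * v ^ 2) (by
      have := hx.mul hσx
      rwa [show (x : K) * σ x = ((u ^ 2 - p * v ^ 2 : ℚ) : K) by
        rw [hσx', huv]; push_cast; linear_combination - v ^ 2 * hα] at this)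
    obtain ⟨b, hb⟩ := Int.exists_eq_of_prime_mul_sq hp (w := 2 * v) (m := a ^ 2 - 4 * N) (by
      push_cast; rw [← ha, ← hN]; ring)
    have hab : a ^ 2 - p * b ^ 2 = 4 * N := by
      have : (a : ℚ) ^ 2 - p * b ^ 2 = 4 * N := by rw [← ha, ← hb, ← hN]; ring
      exact_mod_cast this
    have heven : Even (a - b) := by
      have h1 : Even (a ^ 2 - b ^ 2) := ⟨2 * N + 2 * c * b ^ 2, by rw [hc] at hab; linarith⟩
      rw [Int.even_sub, Int.even_pow' two_ne_zero, Int.even_pow' two_ne_zero] at h1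
      rwa [Int.even_sub]
    obtain ⟨d, hd⟩ := heven
    refine ⟨⟨d, b⟩, RingOfIntegers.ext ?_⟩
    rw [hf, huv]
    have h1 : (u : K) = a / 2 := by
      have : u = a / 2 := by linarith
      rw [this]; push_cast; rfl
    have h2 : (v : K) = b / 2 := by
      have : v = b / 2 := by linarith
      rw [this]; push_cast; rfl
    have h3 : (a : K) - b = d + d := mod_cast congrArg (Int.cast : ℤ → K) hd
    rw [h1, h2]
    linear_combination - h3 / 2
  refine ⟨AlgEquiv.ofBijective f ⟨hinj, hsurj⟩, fun z ↦ ?_⟩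
  change 2 * ((f z : 𝓞 K) : K) = _
  rw [hf]
  ring

theorem discr_eq_of_algEquiv {K : Type*} [Field K] [NumberField K] {c : ℤ}
    (e : QuadraticAlgebra ℤ c 1 ≃ₐ[ℤ] 𝓞 K) : discr K = 4 * c + 1 := by
  rw [← discr_eq_discr K ((QuadraticAlgebra.basis c 1).map e.toLinearEquiv)]
  have : Algebra.discr ℤ ((QuadraticAlgebra.basis c 1).map e.toLinearEquiv) =
      Algebra.discr ℤ (QuadraticAlgebra.basis c (1 : ℤ)) := by
    rw [Algebra.discr_def, Algebra.discr_def]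
    congr 1
    ext i j
    simp only [Algebra.traceMatrix_apply, Algebra.traceForm_apply, Module.Basis.map_apply,
      AlgEquiv.toLinearEquiv_apply, ← map_mul, Algebra.trace_eq_of_algEquiv]
  rw [this, QuadraticAlgebra.discr_basis]
  ring

end QuadraticRing

section Splitting

theorem QuadraticAlgebra.intCast_dvd_iff {c : ℤ} {q : ℤ} {z : QuadraticAlgebra ℤ c 1} :
    (q : QuadraticAlgebra ℤ c 1) ∣ z ↔ q ∣ z.re ∧ q ∣ z.im := by
  constructor
  · rintro ⟨y, rfl⟩
    simp
  · rintro ⟨⟨a, ha⟩, ⟨b, hb⟩⟩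
    exact ⟨⟨a, b⟩, by ext <;> simp [ha, hb]⟩

theorem QuadraticAlgebra.prime_intCast {c : ℤ} {q : ℕ} (hq : q.Prime)
    (h : ∀ a b : ZMod q, a ^ 2 + a * b - c * b ^ 2 = 0 → a = 0 ∧ b = 0) :
    Prime ((q : ℤ) : QuadraticAlgebra ℤ c 1) := by
  have hqZ : Prime (q : ℤ) := Nat.prime_iff_prime_int.mp hq
  have key (z : QuadraticAlgebra ℤ c 1) (hz : (q : ℤ) ∣ z.norm) :
      ((q : ℤ) : QuadraticAlgebra ℤ c 1) ∣ z := by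
    rw [QuadraticAlgebra.intCast_dvd_iff]
    rw [← ZMod.intCast_zmod_eq_zero_iff_dvd, QuadraticAlgebra.norm_def] at hz
    have := h z.re z.im (by push_cast at hz; linear_combination hz)
    rwa [ZMod.intCast_zmod_eq_zero_iff_dvd, ZMod.intCast_zmod_eq_zero_iff_dvd] at this
  refine ⟨?_, ?_, ?_⟩
  · intro h0
    have := congrArg QuadraticAlgebra.re h0
    simp [hq.ne_zero] at this
  · intro hu
    have := QuadraticAlgebra.intCast_dvd_iff.mp (hu.dvd (a := 1))
    exact hqZ.not_dvd_one (by simpa using this.1)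
  · intro x y hxy
    obtain ⟨t, ht⟩ := hxy
    have hN : (q : ℤ) ∣ x.norm * y.norm := by
      rw [← map_mul, ht, map_mul]
      exact Dvd.dvd.mul_right (Dvd.intro (q : ℤ) (by rw [QuadraticAlgebra.norm_def]; simp)) _
    exact (hqZ.dvd_or_dvd hN).imp (key x) (key y)

variable {p : ℕ} [Fact p.Prime] {c : ℤ}

theorem isSquare_of_norm_eq_zero {q : ℕ} [Fact q.Prime] (hc : (p : ℤ) = 4 * c + 1) (hq2 : q ≠ 2)
    {a b : ZMod q} (h : a ^ 2 + a * b - c * b ^ 2 = 0) (hb : b ≠ 0) : IsSquare (q : ZMod p) := by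
  have hp4 : p % 4 = 1 := by lia
  rw [ZMod.exists_sq_eq_prime_iff_of_mod_four_eq_one hp4 hq2]
  have hcq : (p : ZMod q) = 4 * c + 1 := mod_cast congrArg (Int.cast : ℤ → ZMod q) hc
  refine ⟨(2 * a + b) / b, ?_⟩
  field_simp
  rw [hcq]
  linear_combination -4 * h

variable {K : Type*} [Field K] [NumberField K]

theorem prime_span_of_quadraticChar_eq_neg_one (hc : (p : ℤ) = 4 * c + 1) (hc2 : Odd c)
    (e : QuadraticAlgebra ℤ c 1 ≃ₐ[ℤ] 𝓞 K) {q : ℕ} (hq : q.Prime)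
    (hχ : quadraticChar (ZMod p) q = -1) : Prime (Ideal.span {(q : 𝓞 K)}) := by
  have : Fact q.Prime := ⟨hq⟩
  have h1 : Prime ((q : ℤ) : QuadraticAlgebra ℤ c 1) := by
    refine QuadraticAlgebra.prime_intCast hq fun a b h ↦ ?_
    by_cases hq2 : q = 2
    · subst hq2
      have hc' : (c : ZMod 2) = 1 := by
        obtain ⟨d, rfl⟩ := hc2
        push_cast
        rw [show (2 : ZMod 2) = 0 from rfl]
        ring
      rw [hc'] at h
      clear hc'
      decide +revert
    · by_cases hb : b = 0
      · subst hb
        simpa using h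
      · have := isSquare_of_norm_eq_zero hc hq2 h hb
        rw [quadraticChar_neg_one_iff_not_isSquare] at hχ
        exact absurd this hχ
  have h2 : Prime (q : 𝓞 K) := by
    have := (MulEquiv.prime_iff e.toMulEquiv).mpr h1
    simpa using this
  exact Ideal.prime_of_isPrime (by simpa using hq.ne_zero)
    ((Ideal.span_singleton_prime h2.ne_zero).mpr h2)

theorem absNorm_ker {q : ℕ} [NeZero q] (f : 𝓞 K →+* ZMod q) :
    Ideal.absNorm (RingHom.ker f) = q := by
  have hf : Function.Surjective f := ZMod.ringHom_surjective f
  rw [Ideal.absNorm_apply, Submodule.cardQuot_apply,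
    Nat.card_congr (RingHom.quotientKerEquivOfSurjective hf).toEquiv, Nat.card_zmod]

theorem exists_split_of_quadraticChar_eq_one (hc : (p : ℤ) = 4 * c + 1)
    (e : QuadraticAlgebra ℤ c 1 ≃ₐ[ℤ] 𝓞 K) (hdeg : Module.finrank ℚ K = 2)
    {q : ℕ} (hq : q.Prime) (hq2 : q ≠ 2) (hχ : quadraticChar (ZMod p) q = 1) :
    ∃ P Q : Ideal (𝓞 K), Prime P ∧ Prime Q ∧ P ≠ Q ∧ Ideal.absNorm P = q ∧ Ideal.absNorm Q = q ∧
      P * Q = Ideal.span {(q : 𝓞 K)} := by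
  have : Fact q.Prime := ⟨hq⟩
  have hp4 : p % 4 = 1 := by lia
  have hq0 : (q : ZMod p) ≠ 0 := by
    intro h; rw [h] at hχ; simp at hχ
  have hpq : p ≠ q := by
    rintro rfl; simp at hq0
  rw [quadraticChar_one_iff_isSquare hq0, ZMod.exists_sq_eq_prime_iff_of_mod_four_eq_one hp4 hq2]
    at hχ
  obtain ⟨s, hs⟩ := hχ
  have hcq : (p : ZMod q) = 4 * c + 1 := mod_cast congrArg (Int.cast : ℤ → ZMod q) hc
  have h2 : (2 : ZMod q) ≠ 0 := by
    have := (ZMod.natCast_eq_zero_iff 2 q).not.mpr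
      (fun h ↦ hq2 ((Nat.prime_dvd_prime_iff_eq hq Nat.prime_two).mp h))
    simpa using this
  have hs0 : s ≠ 0 := by
    rintro rfl
    rw [mul_zero, ZMod.natCast_eq_zero_iff] at hs
    exact hpq ((Nat.prime_dvd_prime_iff_eq hq Fact.out).mp hs).symm
  obtain ⟨r, hr⟩ : ∃ r : ZMod q, 2 * r = 1 + s := ⟨(1 + s) / 2, by field_simp⟩
  have hrr : r * r = c + r := by
    have h4 : (2 : ZMod q) * 2 ≠ 0 := mul_ne_zero h2 h2
    refine mul_left_cancel₀ h4 ?_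
    linear_combination (2 * r - 1 + s) * hr - hs + hcq
  let f (t : ZMod q) (ht : t * t = c + t) : 𝓞 K →+* ZMod q :=
    (QuadraticAlgebra.lift (R := ℤ) (a := c) (b := 1) ⟨t, by simp [ht]⟩).toRingHom.comp
      e.symm.toRingEquiv.toRingHom
  have hf (t ht) : f t ht (e QuadraticAlgebra.omega) = t := by
    simp [f, QuadraticAlgebra.lift]
  have hr' : (1 - r) * (1 - r) = c + (1 - r) := by linear_combination hrr
  have hPne (g : 𝓞 K →+* ZMod q) : RingHom.ker g ≠ ⊥ := fun h ↦ by
    have := absNorm_ker g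
    rw [h] at this
    simp at this
    exact hq.ne_zero this.symm
  have hne : RingHom.ker (f r hrr) ≠ RingHom.ker (f (1 - r) hr') := by
    intro h
    obtain ⟨n, hn⟩ := ZMod.natCast_zmod_surjective r
    have h1 : e QuadraticAlgebra.omega - (n : 𝓞 K) ∈ RingHom.ker (f r hrr) := by
      rw [RingHom.mem_ker, map_sub, hf r hrr, map_natCast, hn, sub_self]
    rw [h, RingHom.mem_ker, map_sub, hf (1 - r) hr', map_natCast, hn] at h1
    exact hs0 (by linear_combination -h1 - hr)
  have hprime (g : 𝓞 K →+* ZMod q) : Prime (RingHom.ker g) :=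
    Ideal.prime_of_isPrime (hPne g) (RingHom.ker_isPrime g)
  refine ⟨_, _, hprime _, hprime _, hne, absNorm_ker _, absNorm_ker _, ?_⟩
  have hcop : IsCoprime (RingHom.ker (f r hrr)) (RingHom.ker (f (1 - r) hr')) := by
    have hm1 := (RingHom.ker_isPrime (f r hrr)).isMaximal (hPne _)
    have hm2 := (RingHom.ker_isPrime (f (1 - r) hr')).isMaximal (hPne _)
    exact Ideal.isCoprime_iff_sup_eq.mpr (hm1.coprime_of_ne hm2 hne)
  have hmem (g : 𝓞 K →+* ZMod q) : RingHom.ker g ∣ Ideal.span {(q : 𝓞 K)} := by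
    rw [Ideal.dvd_span_singleton, RingHom.mem_ker, map_natCast, ZMod.natCast_self]
  obtain ⟨R, hR⟩ := hcop.mul_dvd (hmem _) (hmem _)
  have hN := congrArg Ideal.absNorm hR
  rw [absNorm_span_natCast hdeg, map_mul, map_mul, absNorm_ker, absNorm_ker, pow_two] at hN
  have hR1 : Ideal.absNorm R = 1 :=
    mul_left_cancel₀ (mul_ne_zero hq.ne_zero hq.ne_zero) (by rw [← hN, mul_one])
  rw [Ideal.absNorm_eq_one_iff] at hR1
  rw [hR, hR1, Ideal.mul_top]

theorem exists_ramified (hc : (p : ℤ) = 4 * c + 1)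
    (e : QuadraticAlgebra ℤ c 1 ≃ₐ[ℤ] 𝓞 K) (hdeg : Module.finrank ℚ K = 2) :
    ∃ P : Ideal (𝓞 K), Prime P ∧ Ideal.absNorm P = p ∧ P ^ 2 = Ideal.span {(p : 𝓞 K)} := by
  have hp : p.Prime := Fact.out
  have ha : e (⟨-1, 2⟩) ^ 2 = (p : 𝓞 K) := by
    rw [← map_pow, ← map_natCast e]
    congr 1
    rw [← Int.cast_natCast]
    ext
    · simp [pow_two]; linarith
    · simp [pow_two]
  have h2 : Ideal.span {e (⟨-1, 2⟩)} ^ 2 = Ideal.span {(p : 𝓞 K)} := by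
    rw [Ideal.span_singleton_pow, ha]
  have hN : Ideal.absNorm (Ideal.span {e (⟨-1, 2⟩)}) = p := by
    have := congrArg Ideal.absNorm h2
    rw [map_pow, absNorm_span_natCast hdeg] at this
    exact Nat.pow_left_injective two_ne_zero this
  refine ⟨_, Ideal.prime_of_isPrime ?_ (Ideal.isPrime_of_irreducible_absNorm ?_), hN, h2⟩
  · intro h
    rw [h, Ideal.absNorm_bot] at hN
    exact hp.ne_zero hN.symm
  · rw [hN]; exact hp

/-- The quadratic residue symbol modulo `p`, as an arithmetic function. -/
noncomputable def quadraticArith (p : ℕ) [Fact p.Prime] : ArithmeticFunction ℤ where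
  toFun n := quadraticChar (ZMod p) n
  map_zero' := by simp

theorem isMultiplicative_quadraticArith : (quadraticArith p).IsMultiplicative := by
  refine ⟨by simp [quadraticArith], ?_⟩
  simp only [quadraticArith, ArithmeticFunction.coe_mk, Nat.cast_mul, map_mul, implies_true]

open ArithmeticFunction in
theorem idealCount_eq_zeta_mul (hc : (p : ℤ) = 4 * c + 1) (hc2 : Odd c)
    (e : QuadraticAlgebra ℤ c 1 ≃ₐ[ℤ] 𝓞 K) (hdeg : Module.finrank ℚ K = 2) :
    ((idealCount K : ArithmeticFunction ℕ) : ArithmeticFunction ℤ) =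
      (ArithmeticFunction.zeta : ArithmeticFunction ℤ) * quadraticArith p := by
  have hp : p.Prime := Fact.out
  have hp2 : p ≠ 2 := by lia
  have hm1 : ((idealCount K : ArithmeticFunction ℕ) : ArithmeticFunction ℤ).IsMultiplicative :=
    isMultiplicative_idealCount.natCast
  have hm2 : ((ArithmeticFunction.zeta : ArithmeticFunction ℤ) *
      quadraticArith p).IsMultiplicative :=
    isMultiplicative_zeta.natCast.mul isMultiplicative_quadraticArith
  rw [hm1.eq_iff_eq_on_prime_powers _ _ hm2]
  intro q k hq
  have hR : ((ArithmeticFunction.zeta : ArithmeticFunction ℤ) * quadraticArith p) (q ^ k) =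
      ∑ i ∈ Finset.range (k + 1), (quadraticChar (ZMod p) q) ^ i := by
    rw [coe_zeta_mul_apply, Nat.sum_divisors_prime_pow hq]
    simp only [quadraticArith, coe_mk, Nat.cast_pow, map_pow]
  rw [hR, natCoe_apply]
  by_cases hqp : q = p
  · subst hqp
    obtain ⟨P, hP, hPq, hP2⟩ := exists_ramified hc e hdeg
    rw [idealCount_prime_pow_of_ramified hq hP hPq hP2, Finset.sum_range_succ']
    simp
  have hq0 : (q : ZMod p) ≠ 0 := fun h ↦
    hqp ((Nat.prime_dvd_prime_iff_eq hp hq).mp ((ZMod.natCast_eq_zero_iff _ _).mp h)).symm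
  rcases quadraticChar_dichotomy hq0 with hχ | hχ
  · have hq2 : q ≠ 2 := by
      rintro rfl
      rw [quadraticChar_one_iff_isSquare hq0] at hχ
      have := (ZMod.exists_sq_eq_two_iff hp2).mp (by simpa using hχ)
      obtain ⟨d, rfl⟩ := hc2
      lia
    obtain ⟨P, Q, hP, hQ, hne, hPq, hQq, hPQ⟩ :=
      exists_split_of_quadraticChar_eq_one hc e hdeg hq hq2 hχ
    rw [idealCount_prime_pow_of_split hq hP hQ hne hPq hQq hPQ, hχ]
    simp
  · rw [idealCount_prime_pow_of_inert hdeg hq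
      (prime_span_of_quadraticChar_eq_neg_one hc hc2 e hq hχ), hχ, neg_one_geom_sum]
    simp [Nat.even_add_one, -Nat.not_even_iff_odd]

end Splitting

section ClassNumberFormula

variable {p : ℕ} [Fact p.Prime] {c : ℤ} {K : Type*} [Field K] [NumberField K]

theorem LSeriesSummable_quadraticChar {s : ℂ} (hs : 1 < s.re) :
    LSeriesSummable (fun n ↦ ((quadraticChar (ZMod p) n : ℤ) : ℂ)) s := by
  simpa using ZMod.LSeriesSummable_of_one_lt_re
    (fun a ↦ ((quadraticChar (ZMod p) a : ℤ) : ℂ)) hs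

open ArithmeticFunction Filter Topology in
theorem tendsto_LSeries_quadraticChar (hc : (p : ℤ) = 4 * c + 1) (hc2 : Odd c)
    (e : QuadraticAlgebra ℤ c 1 ≃ₐ[ℤ] 𝓞 K) (hdeg : Module.finrank ℚ K = 2) :
    Tendsto (fun s : ℝ ↦ LSeries (fun n ↦ ((quadraticChar (ZMod p) n : ℤ) : ℂ)) s) (𝓝[>] 1)
      (𝓝 (dedekindZeta_residue K)) := by
  have hprod {s : ℂ} (hs : 1 < s.re) : dedekindZeta K s =
      riemannZeta s * LSeries (fun n ↦ ((quadraticChar (ZMod p) n : ℤ) : ℂ)) s := by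
    let f : ArithmeticFunction ℂ := (quadraticArith p : ArithmeticFunction ℂ)
    have hf : (fun n : ℕ ↦ ((quadraticChar (ZMod p) n : ℤ) : ℂ)) = fun n ↦ f n := rfl
    rw [hf, ← LSeries_zeta_eq_riemannZeta hs]
    have := LSeries_mul' (f := ((ArithmeticFunction.zeta : ArithmeticFunction ℕ) :
      ArithmeticFunction ℂ)) (g := f) (s := s)
      (by simpa using LSeriesSummable_zeta_iff.mpr hs)
      (by rw [← hf]; exact LSeriesSummable_quadraticChar hs)
    refine Eq.trans ?_ this
    refine LSeries_congr (fun {n} hn ↦ ?_) s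
    have h := congrArg (fun g : ArithmeticFunction ℤ ↦ ((g n : ℤ) : ℂ))
      (idealCount_eq_zeta_mul hc hc2 e hdeg)
    simp only [natCoe_apply, idealCount_apply hn] at h
    rw [← Int.cast_natCast, h, coe_zeta_mul_apply, coe_zeta_mul_apply]
    push_cast
    rfl
  have h1 := tendsto_sub_one_mul_dedekindZeta_nhdsGT K
  have h2 : Tendsto (fun s : ℝ ↦ ((s : ℂ) - 1) * riemannZeta s) (𝓝[>] 1) (𝓝 1) := by
    refine riemannZeta_residue_one.comp (tendsto_nhdsWithin_iff.mpr ⟨?_, ?_⟩)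
    · exact (Complex.continuous_ofReal.tendsto' 1 1 (by simp)).mono_left nhdsWithin_le_nhds
    · filter_upwards [self_mem_nhdsWithin] with s hs
      simpa using (ne_of_gt hs)
  have h3 := h1.div h2 one_ne_zero
  rw [div_one] at h3
  refine h3.congr' ?_
  filter_upwards [self_mem_nhdsWithin] with s hs
  have hs' : 1 < (s : ℂ).re := by simpa using hs
  have hs1 : (s : ℂ) - 1 ≠ 0 := by
    rw [sub_ne_zero]; exact_mod_cast (ne_of_gt hs)
  rw [Pi.div_apply, hprod hs']
  have := riemannZeta_ne_zero_of_one_lt_re hs'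
  field_simp

theorem isTotallyReal_of_sq_eq {p : ℕ} (hp : p.Prime) {α : K} (hα : α ^ 2 = p)
    (hdeg : Module.finrank ℚ K = 2) : IsTotallyReal K := by
  refine ⟨fun v ↦ ?_⟩
  obtain ⟨σ, -, -, hspan⟩ := exists_eq_add_mul hp hα hdeg
  rw [InfinitePlace.isReal_iff, ComplexEmbedding.isReal_iff]
  set φ := v.embedding
  have hφ : (φ α) ^ 2 = ((Real.sqrt p : ℝ) : ℂ) ^ 2 := by
    rw [← map_pow, hα, ← Complex.ofReal_pow, Real.sq_sqrt (by positivity)]; simp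
  have hreal : star (φ α) = φ α := by
    rcases sq_eq_sq_iff_eq_or_eq_neg.mp hφ with h | h <;> simp [h]
  ext x
  obtain ⟨u, w, rfl⟩ := hspan x
  rw [ComplexEmbedding.conjugate_coe_eq]
  simp only [map_add, map_mul, map_ratCast]
  congr 2

theorem torsionOrder_eq_two_of_isTotallyReal [IsTotallyReal K] : Units.torsionOrder K = 2 := by
  classical
  obtain ⟨v⟩ := (inferInstance : Nonempty (InfinitePlace K))
  have hφ := IsTotallyReal.complexEmbedding_isReal v.embedding
  have key (x : Units.torsion K) : (x : (𝓞 K)ˣ) = 1 ∨ (x : (𝓞 K)ˣ) = -1 := by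
    have h1 := (Units.mem_torsion K).mp x.2 v
    rw [← InfinitePlace.norm_embedding_eq, ← hφ.coe_embedding_apply, Complex.norm_real,
      Real.norm_eq_abs, abs_eq zero_le_one, ← map_one hφ.embedding, ← map_neg,
      hφ.embedding.injective.eq_iff, hφ.embedding.injective.eq_iff] at h1
    refine h1.imp (fun h ↦ ?_) fun h ↦ ?_ <;>
      exact Units.ext (RingOfIntegers.ext (by simpa using h))
  let := Fintype.ofFinite (Units.torsion K)
  rw [Units.torsionOrder, Nat.card_eq_fintype_card]
  refine (Finset.card_eq_two.2 ⟨1, ⟨-1, neg_one_mem_torsion⟩,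
    by simp [← Subtype.coe_ne_coe], Finset.ext fun x ↦ ⟨fun _ ↦ ?_, fun _ ↦ Finset.mem_univ _⟩⟩)
  rw [Finset.mem_insert, Finset.mem_singleton, ← Subtype.val_inj, ← Subtype.val_inj]
  exact key x

theorem regulator_eq_abs_log [IsTotallyReal K] (hdeg : Module.finrank ℚ K = 2) {ε : (𝓞 K)ˣ}
    (hfund : ∀ u : (𝓞 K)ˣ, ∃ n : ℤ, u = ε ^ n ∨ u = -ε ^ n) (v : InfinitePlace K) :
    Units.regulator K = |Real.log (v (ε : K))| := by
  classical
  have hcard : Fintype.card (InfinitePlace K) = 2 := by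
    have h1 := InfinitePlace.card_eq_nrRealPlaces_add_nrComplexPlaces K
    have h2 := IsTotallyReal.finrank (K := K)
    have h3 := IsTotallyReal.nrComplexPlaces_eq_zero (K := K)
    lia
  have hrank : Units.rank K = 1 := by rw [Units.rank, hcard]
  have hidx :
      Subgroup.closure (Set.range fun _ : Fin (Units.rank K) ↦ ε) ⊔ Units.torsion K = ⊤ := by
    have hne : Nonempty (Fin (Units.rank K)) := ⟨⟨0, by lia⟩⟩
    rw [Set.range_const, eq_top_iff]
    intro u _
    have hmem (n : ℤ) : ε ^ n ∈ Subgroup.closure {ε} :=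
      Subgroup.zpow_mem _ (Subgroup.subset_closure (Set.mem_singleton ε)) n
    obtain ⟨n, h | h⟩ := hfund u
    · rw [h]
      exact Subgroup.mem_sup_left (hmem n)
    · rw [h, ← mul_neg_one]
      exact Subgroup.mul_mem_sup (hmem n) neg_one_mem_torsion
  have hreg := Units.regOfFamily_div_regulator (K := K) fun _ ↦ ε
  rw [hidx, Subgroup.index_top, Nat.cast_one, div_eq_one_iff_eq (Units.regulator_ne_zero K)] at hreg
  obtain ⟨w, hw⟩ : ∃ w : InfinitePlace K, v ≠ w := by
    by_contra! h
    have := Fintype.card_le_one_iff.mpr (fun a b ↦ (h a).symm.trans (h b))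
    lia
  have huniq : ∀ x : {x // x ≠ w}, x = ⟨v, hw⟩ := by
    have : Fintype.card {x // x ≠ w} ≤ 1 := by
      rw [Fintype.card_subtype_compl, hcard]; simp
    exact fun x ↦ Fintype.card_le_one_iff.mp this _ _
  let : Unique {x // x ≠ w} := ⟨⟨⟨v, hw⟩⟩, huniq⟩
  have e : {x // x ≠ w} ≃ Fin (Units.rank K) := Fintype.equivOfCardEq (by simp [hrank])
  rw [← hreg, Units.regOfFamily_eq_det _ w e, Matrix.det_unique]
  simp only [Matrix.of_apply, IsTotallyReal.mult_eq, Nat.cast_one, one_mul]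
  rfl

theorem dedekindZeta_residue_eq {p : ℕ} (hp : p.Prime) {α : K} (hα : α ^ 2 = p)
    (hdeg : Module.finrank ℚ K = 2) (hdisc : discr K = p) {ε : (𝓞 K)ˣ}
    (hfund : ∀ u : (𝓞 K)ˣ, ∃ n : ℤ, u = ε ^ n ∨ u = -ε ^ n) (φ : K →+* ℂ) :
    dedekindZeta_residue K = 2 * classNumber K * |Real.log ‖φ ε‖| / Real.sqrt p := by
  have := isTotallyReal_of_sq_eq hp hα hdeg
  have h2 := IsTotallyReal.finrank (K := K)
  rw [dedekindZeta_residue_def, torsionOrder_eq_two_of_isTotallyReal,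
    regulator_eq_abs_log hdeg hfund (InfinitePlace.mk φ), IsTotallyReal.nrComplexPlaces_eq_zero,
    ← h2, hdeg, hdisc, InfinitePlace.apply]
  push_cast
  rw [abs_of_nonneg (by positivity : (0 : ℝ) ≤ p)]
  have : Real.sqrt p ≠ 0 := by
    have := hp.pos
    positivity
  field_simp

end ClassNumberFormula

section AbelLimit

open Filter Topology MeasureTheory

theorem tendsto_sum_div_of_tendsto_LSeries {f : ℕ → ℂ} (hf0 : f 0 = 0) {C : ℝ}
    (hC : ∀ n, ‖∑ k ∈ Finset.Icc 1 n, f k‖ ≤ C) (hsum : ∀ s : ℝ, 1 < s → LSeriesSummable f s)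
    {l : ℂ} (h : Tendsto (fun s : ℝ ↦ LSeries f s) (𝓝[>] 1) (𝓝 l)) :
    Tendsto (fun n ↦ ∑ k ∈ Finset.range n, f k / k) atTop (𝓝 l) := by
  set S : ℝ → ℂ := fun t ↦ ∑ k ∈ Finset.Icc 1 ⌊t⌋₊, f k
  have hSm : Measurable S :=
    (measurable_from_nat (f := fun n ↦ ∑ k ∈ Finset.Icc 1 n, f k)).comp Nat.measurable_floor
  have hint : IntegrableOn (fun t : ℝ ↦ C * t ^ (-2 : ℝ)) (Set.Ioi 1) :=
    (integrableOn_Ioi_rpow_of_lt (by norm_num) one_pos).const_mul C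
  have hnorm {s : ℝ} {t : ℝ} (hs : 1 ≤ s) (ht : 1 < t) :
      ‖S t * (t : ℂ) ^ (-((s : ℂ) + 1))‖ ≤ C * t ^ (-2 : ℝ) := by
    rw [norm_mul, Complex.norm_cpow_eq_rpow_re_of_pos (by linarith)]
    have hC0 : 0 ≤ C := (norm_nonneg _).trans (hC 0)
    refine mul_le_mul (hC _) (Real.rpow_le_rpow_of_exponent_le ht.le ?_) (by positivity) hC0
    simp; linarith
  have hlim : Tendsto
      (fun s : ℝ ↦ (s : ℂ) * ∫ t in Set.Ioi (1 : ℝ), S t * (t : ℂ) ^ (-((s : ℂ) + 1)))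
      (𝓝[>] 1) (𝓝 (1 * ∫ t in Set.Ioi (1 : ℝ), S t * (t : ℂ) ^ (-((1 : ℂ) + 1)))) := by
    have hs1 : Tendsto (fun s : ℝ ↦ (s : ℂ)) (𝓝[>] 1) (𝓝 1) :=
      (Complex.continuous_ofReal.tendsto' 1 1 (by simp)).mono_left nhdsWithin_le_nhds
    refine hs1.mul ?_
    refine tendsto_integral_filter_of_dominated_convergence _ ?_ ?_ hint ?_
    · exact Eventually.of_forall fun s ↦ (hSm.mul (by fun_prop)).aestronglyMeasurable
    · filter_upwards [self_mem_nhdsWithin] with s hs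
      filter_upwards [ae_restrict_mem measurableSet_Ioi] with t ht
      exact hnorm (le_of_lt hs) ht
    · filter_upwards [ae_restrict_mem measurableSet_Ioi] with t ht
      refine Tendsto.const_mul _ (Tendsto.const_cpow (hs1.add_const 1).neg (Or.inl ?_))
      exact_mod_cast (zero_lt_one.trans ht).ne'
  have hl : l = ∫ t in Set.Ioi (1 : ℝ), S t * (t : ℂ) ^ (-((1 : ℂ) + 1)) := by
    rw [one_mul] at hlim
    refine tendsto_nhds_unique (h.congr' ?_) hlim
    filter_upwards [self_mem_nhdsWithin] with s hs
    have hs' : (1 : ℝ) < s := hs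
    refine LSeries_eq_mul_integral f le_rfl (by simpa using zero_lt_one.trans hs') (hsum s hs) ?_
    simp only [Real.rpow_zero]
    exact Asymptotics.isBigO_of_le' (c := C) _ fun n ↦ by simpa using hC n
  have hderiv {t : ℝ} (ht : 1 ≤ t) : HasDerivAt (fun x : ℝ ↦ (x : ℂ)⁻¹) (-((t : ℂ) ^ 2)⁻¹) t := by
    have ht0 : (t : ℂ) ≠ 0 := by exact_mod_cast (by linarith : t ≠ 0)
    simpa using (hasDerivAt_inv ht0).comp_ofReal
  have hSS (t : ℝ) : ∑ k ∈ Finset.Icc 0 ⌊t⌋₊, f k = S t := by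
    rw [← Finset.add_sum_Ioc_eq_sum_Icc (Nat.zero_le _), hf0, zero_add]
    rfl
  have hS0 (n : ℕ) : ‖∑ k ∈ Finset.Icc 0 n, f k‖ ≤ C := by
    have := hSS n
    rw [Nat.floor_natCast] at this
    rw [this]; exact hC _
  have key := tendsto_sum_mul_atTop_nhds_one_sub_integral₀ (𝕜 := ℂ) f (f := fun x : ℝ ↦ (x : ℂ)⁻¹)
    hf0 (fun t ht ↦ (hderiv ht).differentiableAt) ?_ (l := 0) ?_
    (g := fun t ↦ C * t ^ (-2 : ℝ)) ?_ ?_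
  · rw [← tendsto_add_atTop_iff_nat 1]
    have hl2 : l = 0 - ∫ t in Set.Ioi (1 : ℝ), deriv (fun x : ℝ ↦ (x : ℂ)⁻¹) t *
        ∑ k ∈ Finset.Icc 0 ⌊t⌋₊, f k := by
      rw [hl, zero_sub, ← integral_neg]
      refine setIntegral_congr_fun measurableSet_Ioi fun t ht ↦ ?_
      have ht' : (1 : ℝ) < t := ht
      have ht0 : (t : ℂ) ≠ 0 := by exact_mod_cast (by linarith : t ≠ 0)
      simp only [(hderiv ht'.le).deriv, hSS]
      rw [Complex.cpow_neg, show (1 : ℂ) + 1 = (2 : ℕ) by norm_num, Complex.cpow_natCast]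
      ring
    rw [hl2]
    refine key.congr fun n ↦ ?_
    rw [Nat.range_succ_eq_Icc_zero]
    exact Finset.sum_congr rfl fun k _ ↦ by simp [div_eq_inv_mul]
  · refine ContinuousOn.locallyIntegrableOn ?_ measurableSet_Ici
    have : ContinuousOn (fun t : ℝ ↦ -((t : ℂ) ^ 2)⁻¹) (Set.Ici 1) := by
      refine ContinuousOn.neg (ContinuousOn.inv₀ (by fun_prop) fun t ht ↦ ?_)
      have ht' : (1 : ℝ) ≤ t := ht
      exact pow_ne_zero 2 (by exact_mod_cast (by linarith : t ≠ 0))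
    exact this.congr fun t ht ↦ (hderiv ht).deriv
  · refine squeeze_zero_norm (a := fun n : ℕ ↦ (n : ℝ)⁻¹ * C) (fun n ↦ ?_) ?_
    · rw [norm_mul]
      simpa using mul_le_mul_of_nonneg_left (hS0 n) (by positivity : (0 : ℝ) ≤ (n : ℝ)⁻¹)
    · simpa using tendsto_inv_atTop_nhds_zero_nat.mul_const C
  · refine Asymptotics.IsBigO.of_bound 1 ?_
    filter_upwards [eventually_ge_atTop 1] with t ht
    have ht0 : 0 < t := by linarith
    have hC0 : 0 ≤ C := (norm_nonneg _).trans (hC 0)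
    rw [(hderiv ht).deriv, hSS, norm_mul, one_mul, Real.norm_of_nonneg (by positivity), mul_comm C,
      norm_neg, norm_inv, norm_pow, Complex.norm_of_nonneg ht0.le, Real.rpow_neg ht0.le,
      Real.rpow_two]
    exact mul_le_mul_of_nonneg_left (hC _) (inv_nonneg.mpr (sq_nonneg t))
  · exact ⟨Set.Ioi 1, Ioi_mem_atTop 1, hint⟩

end AbelLimit

section LValue

open Filter Topology

variable {p : ℕ} [Fact p.Prime]

theorem norm_sum_Icc_le_of_periodic {f : ℕ → ℂ} {m : ℕ} (hm : 0 < m) (hf : Function.Periodic f m)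
    (hf0 : f 0 = 0) (hsum : ∑ k ∈ Finset.range m, f k = 0) (hle : ∀ k, ‖f k‖ ≤ 1) (n : ℕ) :
    ‖∑ k ∈ Finset.Icc 1 n, f k‖ ≤ m := by
  have hmul (a : ℕ) : ∑ k ∈ Finset.range (a * m), f k = 0 := by
    induction a with
    | zero => simp
    | succ a ih =>
      rw [add_mul, one_mul, Finset.sum_range_add, ih, zero_add, ← hsum]
      refine Finset.sum_congr rfl fun k _ ↦ ?_
      rw [add_comm]
      exact hf.nat_mul a k
  have h1 : ∑ k ∈ Finset.Icc 1 n, f k = ∑ k ∈ Finset.range (n + 1), f k := by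
    rw [Nat.range_succ_eq_Icc_zero, ← Finset.add_sum_Ioc_eq_sum_Icc (Nat.zero_le _), hf0, zero_add]
    rfl
  rw [h1, ← Nat.div_add_mod' (n + 1) m, Finset.sum_range_add, hmul, zero_add]
  refine (norm_sum_le_of_le _ fun k _ ↦ hle _).trans ?_
  simpa using (Nat.mod_lt (n + 1) hm).le

/-- The quadratic character modulo `p`, with complex values. -/
noncomputable def quadraticCharComplex (p : ℕ) [Fact p.Prime] : MulChar (ZMod p) ℂ :=
  (quadraticChar (ZMod p)).ringHomComp (Int.castRingHom ℂ)

theorem quadraticCharComplex_apply (a : ZMod p) :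
    quadraticCharComplex p a = ((quadraticChar (ZMod p) a : ℤ) : ℂ) := rfl

theorem quadraticCharComplex_zero : quadraticCharComplex p 0 = 0 := by
  simp [quadraticCharComplex_apply]

theorem quadraticCharComplex_ne_one (hp2 : p ≠ 2) : quadraticCharComplex p ≠ 1 :=
  (MulChar.ringHomComp_ne_one_iff (RingHom.injective_int _)).mpr
    (quadraticChar_ne_one (by rwa [ZMod.ringChar_zmod_n]))

theorem quadraticCharComplex_isQuadratic : (quadraticCharComplex p).IsQuadratic :=
  (quadraticChar_isQuadratic (ZMod p)).comp _

theorem norm_sum_quadraticChar_le (hp2 : p ≠ 2) (n : ℕ) :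
    ‖∑ k ∈ Finset.Icc 1 n, ((quadraticChar (ZMod p) k : ℤ) : ℂ)‖ ≤ p := by
  refine norm_sum_Icc_le_of_periodic (f := fun k ↦ ((quadraticChar (ZMod p) k : ℤ) : ℂ))
    (Fact.out : p.Prime).pos (fun k ↦ by simp) (by simp) ?_ (fun k ↦ ?_) n
  · rw [← MulChar.sum_eq_zero_of_ne_one (quadraticCharComplex_ne_one hp2)]
    refine Finset.sum_nbij' (fun k ↦ (k : ZMod p)) ZMod.val (by simp)
      (fun a _ ↦ Finset.mem_range.mpr (ZMod.val_lt a))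
      (fun k hk ↦ ZMod.val_cast_of_lt (Finset.mem_range.mp hk)) (by simp)
      (by simp [quadraticCharComplex_apply])
  · rcases quadraticChar_isQuadratic (ZMod p) k with h | h | h <;> rw [h] <;> simp

theorem gaussSum_mul_quadraticCharComplex (hp2 : p ≠ 2) (a : ZMod p) :
    gaussSum (quadraticCharComplex p) ZMod.stdAddChar * quadraticCharComplex p a =
      ∑ b, quadraticCharComplex p b * ZMod.stdAddChar (a * b) := by
  by_cases ha : a = 0
  · simp [ha, quadraticCharComplex_zero,
      MulChar.sum_eq_zero_of_ne_one (quadraticCharComplex_ne_one hp2)]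
  · have h := gaussSum_mulShift_eq (quadraticCharComplex p) ZMod.stdAddChar (Units.mk0 a ha)
    rw [quadraticCharComplex_isQuadratic.inv, mul_comm, Units.val_mk0] at h
    exact h.symm

theorem gaussSum_quadraticCharComplex_sq (hp4 : p % 4 = 1) :
    gaussSum (quadraticCharComplex p) ZMod.stdAddChar ^ 2 = p := by
  have hp2 : p ≠ 2 := by lia
  have h := gaussSum_sq (χ := quadraticCharComplex p) (quadraticCharComplex_ne_one hp2)
    quadraticCharComplex_isQuadratic (ZMod.isPrimitive_stdAddChar p)
  rw [h, ZMod.card, quadraticCharComplex_apply,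
    (quadraticChar_one_iff_isSquare (by simp)).mpr
      (ZMod.exists_sq_eq_neg_one_iff.mpr (by lia))]
  simp

theorem norm_stdAddChar (a : ZMod p) : ‖(ZMod.stdAddChar a : ℂ)‖ = 1 := by
  rw [ZMod.stdAddChar_apply, Circle.norm_coe]

theorem stdAddChar_ne_one {a : ZMod p} (ha : a ≠ 0) : (ZMod.stdAddChar a : ℂ) ≠ 1 := by
  rw [← AddChar.map_zero_eq_one (ZMod.stdAddChar (N := p))]
  exact ZMod.injective_stdAddChar.ne ha

theorem one_sub_mem_slitPlane {z : ℂ} (hz : ‖z‖ = 1) (hz1 : z ≠ 1) : 1 - z ∈ Complex.slitPlane := by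
  left
  rw [Complex.sub_re, Complex.one_re, sub_pos]
  refine lt_of_le_of_ne ((Complex.re_le_norm z).trans hz.le) fun h ↦ hz1 ?_
  have := Complex.sq_norm_sub_sq_re z
  rw [hz, h] at this
  refine Complex.ext h ?_
  simpa using this.symm

theorem gaussSum_mul_eq_neg_sum_log (hp2 : p ≠ 2) {l : ℂ}
    (h : Tendsto (fun s : ℝ ↦ LSeries (fun n ↦ ((quadraticChar (ZMod p) n : ℤ) : ℂ)) s)
      (𝓝[>] 1) (𝓝 l)) :
    gaussSum (quadraticCharComplex p) ZMod.stdAddChar * l =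
      -∑ a, quadraticCharComplex p a * Complex.log (1 - ZMod.stdAddChar a) := by
  set τ := gaussSum (quadraticCharComplex p) ZMod.stdAddChar
  have h1 := tendsto_sum_div_of_tendsto_LSeries (by simp) (norm_sum_quadraticChar_le hp2)
    (fun s hs ↦ LSeriesSummable_quadraticChar (by simpa using hs)) h
  have h2 := (Complex.tendsto_tsum_powerSeries_nhdsWithin_lt h1).const_mul τ
  rw [tendsto_map'_iff] at h2
  have h3 : Tendsto (fun x : ℝ ↦ -∑ a, quadraticCharComplex p a *
      Complex.log (1 - ZMod.stdAddChar a * x)) (𝓝[<] 1)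
      (𝓝 (-∑ a, quadraticCharComplex p a * Complex.log (1 - ZMod.stdAddChar a))) := by
    refine (tendsto_finsetSum _ fun a _ ↦ ?_).neg
    by_cases ha : a = 0
    · simp [ha, quadraticCharComplex_zero]
    · refine Tendsto.const_mul _ ?_
      have hc : ContinuousAt (fun x : ℝ ↦ Complex.log (1 - ZMod.stdAddChar a * x)) 1 := by
        refine ContinuousAt.clog (by fun_prop) ?_
        simpa using one_sub_mem_slitPlane (norm_stdAddChar a) (stdAddChar_ne_one ha)
      have := hc.tendsto
      simp only [Complex.ofReal_one, mul_one] at this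
      exact this.mono_left nhdsWithin_le_nhds
  refine tendsto_nhds_unique (h2.congr' ?_) h3
  filter_upwards [Ioo_mem_nhdsLT (zero_lt_one' ℝ)] with x hx
  have hlt (a : ZMod p) : ‖(ZMod.stdAddChar a : ℂ) * x‖ < 1 := by
    rw [norm_mul, norm_stdAddChar, one_mul, Complex.norm_of_nonneg hx.1.le]
    exact hx.2
  have hs := hasSum_sum (s := Finset.univ) fun (a : ZMod p) _ ↦
    (Complex.hasSum_taylorSeries_neg_log (hlt a)).mul_left (quadraticCharComplex p a)
  simp only [mul_neg, Finset.sum_neg_distrib] at hs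
  rw [← hs.tsum_eq, Function.comp_apply, ← tsum_mul_left]
  refine tsum_congr fun n ↦ ?_
  have := gaussSum_mul_quadraticCharComplex hp2 (n : ZMod p)
  have he (b : ZMod p) : (ZMod.stdAddChar ((n : ZMod p) * b) : ℂ) = ZMod.stdAddChar b ^ n := by
    rw [← nsmul_eq_mul, AddChar.map_nsmul_eq_pow]
  rw [← quadraticCharComplex_apply, ← mul_assoc, ← mul_div_assoc, this, Finset.sum_div,
    Finset.sum_mul]
  refine Finset.sum_congr rfl fun b _ ↦ ?_
  rw [he]
  ring

theorem abs_sum_log_eq_sqrt_mul (hp4 : p % 4 = 1) {l : ℝ}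
    (h : Tendsto (fun s : ℝ ↦ LSeries (fun n ↦ ((quadraticChar (ZMod p) n : ℤ) : ℂ)) s)
      (𝓝[>] 1) (𝓝 l)) :
    |∑ a, (quadraticChar (ZMod p) a : ℝ) * Real.log ‖(1 : ℂ) - ZMod.stdAddChar a‖| =
      Real.sqrt p * |l| := by
  have h1 := gaussSum_mul_eq_neg_sum_log (by lia) h
  have h2 : gaussSum (quadraticCharComplex p) ZMod.stdAddChar ^ 2 =
      ((Real.sqrt p : ℝ) : ℂ) ^ 2 := by
    rw [gaussSum_quadraticCharComplex_sq hp4, ← Complex.ofReal_pow, Real.sq_sqrt (by positivity)]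
    simp
  have h3 : (∑ a, quadraticCharComplex p a * Complex.log (1 - ZMod.stdAddChar a)).re =
      ∑ a, (quadraticChar (ZMod p) a : ℝ) * Real.log ‖(1 : ℂ) - ZMod.stdAddChar a‖ := by
    rw [Complex.re_sum]
    refine Finset.sum_congr rfl fun a _ ↦ ?_
    rw [quadraticCharComplex_apply, ← Complex.ofReal_intCast, Complex.re_ofReal_mul, Complex.log_re]
  have h4 := congrArg (fun z : ℂ ↦ |z.re|) h1
  simp only [Complex.neg_re, abs_neg, h3] at h4
  rw [← h4]
  rcases sq_eq_sq_iff_eq_or_eq_neg.mp h2 with h | h <;>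
    simp [h, abs_mul, abs_of_nonneg (Real.sqrt_nonneg _)]

end LValue

section PrimitiveRoot

variable {p : ℕ} [Fact p.Prime] {r : ZMod p}

theorem ZMod.sum_eq_add_sum_range_pow {M : Type*} [AddCommMonoid M] (hr : orderOf r = p - 1)
    (G : ZMod p → M) : ∑ a, G a = G 0 + ∑ j ∈ Finset.range (p - 1), G (r ^ j) := by
  have hr0 : r ≠ 0 := by
    rintro rfl
    have h2 := (Fact.out : p.Prime).two_le
    have h := pow_orderOf_eq_one (0 : ZMod p)
    rw [hr, zero_pow_eq_one₀] at h
    lia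
  have himage : (Finset.range (p - 1)).image (fun j ↦ r ^ j) = Finset.univ.erase 0 := by
    refine Finset.eq_of_subset_of_card_le (fun a ha ↦ ?_) ?_
    · obtain ⟨j, -, rfl⟩ := Finset.mem_image.mp ha
      exact Finset.mem_erase.mpr ⟨pow_ne_zero j hr0, Finset.mem_univ _⟩
    · rw [Finset.card_image_of_injOn, Finset.card_range,
        Finset.card_erase_of_mem (Finset.mem_univ _), Finset.card_univ, ZMod.card]
      rw [← hr, Finset.coe_range]
      exact pow_injOn_Iio_orderOf
  rw [← Finset.add_sum_erase _ _ (Finset.mem_univ 0), ← himage, Finset.sum_image]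
  rw [← hr, Finset.coe_range]
  exact pow_injOn_Iio_orderOf

theorem quadraticChar_eq_neg_one_of_orderOf_eq (hp2 : p ≠ 2) (hr : orderOf r = p - 1) :
    quadraticChar (ZMod p) r = -1 := by
  have hp := (Fact.out : p.Prime)
  have h2 := hp.two_le
  rw [quadraticChar_neg_one_iff_not_isSquare]
  rintro ⟨s, rfl⟩
  have hs0 : s ≠ 0 := by
    rintro rfl
    have h := pow_orderOf_eq_one (0 * 0 : ZMod p)
    rw [hr, mul_zero, zero_pow_eq_one₀] at h
    lia
  have hodd := hp.eq_two_or_odd.resolve_left hp2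
  have h1 : (s * s) ^ ((p - 1) / 2) = 1 := by
    rw [← sq, ← pow_mul, show 2 * ((p - 1) / 2) = p - 1 by lia, ZMod.pow_card_sub_one_eq_one hs0]
  have h3 := Nat.le_of_dvd (by lia) (orderOf_dvd_of_pow_eq_one h1)
  lia

theorem pow_half_eq_neg_one_of_orderOf_eq {g : ℕ} (hg : p = 4 * g + 1) (hr : orderOf r = p - 1) :
    r ^ (2 * g) = -1 := by
  have hp := (Fact.out : p.Prime)
  have hg0 : g ≠ 0 := by rintro rfl; exact hp.ne_one (by lia)
  refine (sq_eq_one_iff.mp ?_).resolve_left fun h ↦ ?_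
  · rw [← pow_mul, show 2 * g * 2 = p - 1 by lia, ← hr, pow_orderOf_eq_one]
  · have := Nat.le_of_dvd (by lia) (orderOf_dvd_of_pow_eq_one h)
    lia

theorem Finset.sum_range_two_mul {M : Type*} [AddCommMonoid M] (f : ℕ → M) (n : ℕ) :
    ∑ j ∈ range (2 * n), f j = ∑ i ∈ range n, (f (2 * i) + f (2 * i + 1)) := by
  induction n with
  | zero => simp
  | succ n ih =>
    rw [mul_add, mul_one, sum_range_succ, sum_range_succ, sum_range_succ, ih, add_assoc]

theorem sum_quadraticChar_mul {R : Type*} [CommRing R] {g : ℕ} (hg : p = 4 * g + 1)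
    (hr : orderOf r = p - 1) (G : ZMod p → R) :
    ∑ a, ((quadraticChar (ZMod p) a : ℤ) : R) * G a =
      ∑ i ∈ Finset.range (2 * g), (G (r ^ (2 * i)) - G (r ^ (2 * i + 1))) := by
  rw [ZMod.sum_eq_add_sum_range_pow hr, show p - 1 = 2 * (2 * g) by lia,
    Finset.sum_range_two_mul]
  have hχ (j : ℕ) : quadraticChar (ZMod p) (r ^ j) = (-1) ^ j := by
    rw [map_pow, quadraticChar_eq_neg_one_of_orderOf_eq (by lia) hr]
  rw [MulChar.map_zero, Int.cast_zero, zero_mul, zero_add]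
  refine Finset.sum_congr rfl fun i _ ↦ ?_
  rw [hχ, hχ, (even_two_mul i).neg_one_pow, (even_two_mul i).add_one.neg_one_pow]
  simp [sub_eq_add_neg]

theorem sum_quadraticChar_mul_of_even {R : Type*} [CommRing R] {g : ℕ} (hg : p = 4 * g + 1)
    (hr : orderOf r = p - 1) {G : ZMod p → R} (hG : ∀ a, G (-a) = G a) :
    ∑ a, ((quadraticChar (ZMod p) a : ℤ) : R) * G a =
      2 * ∑ i ∈ Finset.range g, (G (r ^ (2 * i + 2)) - G (r ^ (2 * i + 1))) := by
  have hadd (j : ℕ) : G (r ^ (2 * g + j)) = G (r ^ j) := by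
    rw [pow_add, pow_half_eq_neg_one_of_orderOf_eq hg hr, neg_one_mul, hG]
  have hshift : ∑ i ∈ Finset.range g, G (r ^ (2 * i + 2)) =
      ∑ i ∈ Finset.range g, G (r ^ (2 * i)) := by
    have h1 := Finset.sum_range_succ (fun i ↦ G (r ^ (2 * i))) g
    rw [Finset.sum_range_succ'] at h1
    have h2 := hadd 0
    simp only [add_zero] at h2
    simpa [h2, mul_add] using h1
  rw [sum_quadraticChar_mul hg hr, two_mul g, Finset.sum_range_add]
  have (i : ℕ) : G (r ^ (2 * (g + i))) - G (r ^ (2 * (g + i) + 1)) =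
      G (r ^ (2 * i)) - G (r ^ (2 * i + 1)) := by
    rw [← hadd (2 * i), ← hadd (2 * i + 1)]
    ring_nf
  simp only [this, Finset.sum_sub_distrib, hshift]
  ring

end PrimitiveRoot

section CyclotomicUnit

variable {p : ℕ} [Fact p.Prime]

/-- The product of the conjugates `ζ ^ 4 ^ i + ζ ^ (- 4 ^ i)`, `i < g`, for `ζ = exp (2πi / p)`. -/
noncomputable def cyclotomicUnit (p : ℕ) [Fact p.Prime] (g : ℕ) : ℂ :=
  ∏ i ∈ Finset.range g, ((ZMod.stdAddChar ((4 : ZMod p) ^ i) : ℂ) +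
    ZMod.stdAddChar (-(4 : ZMod p) ^ i))

theorem norm_stdAddChar_add_neg {a : ZMod p} (ha : 2 * a ≠ 0) :
    ‖(ZMod.stdAddChar a : ℂ) + ZMod.stdAddChar (-a)‖ =
      ‖(1 : ℂ) - ZMod.stdAddChar (4 * a)‖ / ‖(1 : ℂ) - ZMod.stdAddChar (2 * a)‖ := by
  have h1 : (1 : ℂ) - ZMod.stdAddChar (2 * a) ≠ 0 := sub_ne_zero.mpr (stdAddChar_ne_one ha).symm
  rw [eq_div_iff (norm_ne_zero_iff.mpr h1), ← norm_mul, ← one_mul ‖_ * _‖, ← norm_stdAddChar a,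
    ← norm_mul]
  congr 1
  have h2 : (ZMod.stdAddChar a : ℂ) * ZMod.stdAddChar (-a) = 1 := by
    rw [← AddChar.map_add_eq_mul, add_neg_cancel, AddChar.map_zero_eq_one]
  have h3 : (ZMod.stdAddChar (2 * a) : ℂ) = ZMod.stdAddChar a ^ 2 := by
    rw [← AddChar.map_nsmul_eq_pow, nsmul_eq_mul, Nat.cast_ofNat]
  have h4 : (ZMod.stdAddChar (4 * a) : ℂ) = ZMod.stdAddChar a ^ 4 := by
    rw [← AddChar.map_nsmul_eq_pow, nsmul_eq_mul, Nat.cast_ofNat]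
  rw [h3, h4]
  linear_combination (1 - (ZMod.stdAddChar a : ℂ) ^ 2) * h2

theorem norm_one_sub_stdAddChar_neg (a : ZMod p) :
    ‖(1 : ℂ) - ZMod.stdAddChar (-a)‖ = ‖(1 : ℂ) - ZMod.stdAddChar a‖ := by
  rw [← one_mul ‖1 - ZMod.stdAddChar (-a)‖, ← norm_stdAddChar a, ← norm_mul, mul_sub, mul_one,
    ← AddChar.map_add_eq_mul, add_neg_cancel, AddChar.map_zero_eq_one, norm_sub_rev]

theorem two_mul_four_pow_ne_zero (hp2 : p ≠ 2) (i : ℕ) : 2 * (4 : ZMod p) ^ i ≠ 0 := by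
  have h2 : (2 : ZMod p) ≠ 0 := by
    have := ZMod.prime_ne_zero p 2 hp2
    exact mod_cast this
  rw [show (4 : ZMod p) = 2 * 2 by norm_num]
  exact mul_ne_zero h2 (pow_ne_zero _ (mul_ne_zero h2 h2))

theorem norm_cyclotomicUnit_factor_ne_zero (hp2 : p ≠ 2) (i : ℕ) :
    ‖(ZMod.stdAddChar ((4 : ZMod p) ^ i) : ℂ) + ZMod.stdAddChar (-(4 : ZMod p) ^ i)‖ ≠ 0 := by
  rw [norm_stdAddChar_add_neg (two_mul_four_pow_ne_zero hp2 i)]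
  refine div_ne_zero ?_ ?_ <;> refine norm_ne_zero_iff.mpr (sub_ne_zero.mpr
    (stdAddChar_ne_one ?_).symm)
  · rw [show (4 : ZMod p) * 4 ^ i = 2 * (2 * 4 ^ i) by ring]
    have := two_mul_four_pow_ne_zero hp2 i
    exact mul_ne_zero (left_ne_zero_of_mul this) this
  · exact two_mul_four_pow_ne_zero hp2 i

theorem cyclotomicUnit_ne_zero (hp2 : p ≠ 2) (g : ℕ) : cyclotomicUnit p g ≠ 0 :=
  Finset.prod_ne_zero_iff.mpr fun i _ ↦
    norm_ne_zero_iff.mp (norm_cyclotomicUnit_factor_ne_zero hp2 i)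

theorem star_cyclotomicUnit (g : ℕ) : star (cyclotomicUnit p g) = cyclotomicUnit p g := by
  rw [cyclotomicUnit, star_prod]
  refine Finset.prod_congr rfl fun i _ ↦ ?_
  rw [star_add, AddChar.map_neg_eq_conj, Complex.star_def, Complex.conj_conj, add_comm]

theorem sum_quadraticChar_mul_log_eq {g : ℕ} (hg : p = 4 * g + 1)
    (h2 : orderOf (2 : ZMod p) = p - 1) :
    ∑ a, (quadraticChar (ZMod p) a : ℝ) * Real.log ‖(1 : ℂ) - ZMod.stdAddChar a‖ =
      2 * Real.log ‖cyclotomicUnit p g‖ := by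
  have hp2 : p ≠ 2 := by lia
  rw [sum_quadraticChar_mul_of_even hg h2 (G := fun a ↦ Real.log ‖(1 : ℂ) - ZMod.stdAddChar a‖)
    fun a ↦ by rw [norm_one_sub_stdAddChar_neg], cyclotomicUnit, norm_prod,
    Real.log_prod fun i _ ↦ norm_cyclotomicUnit_factor_ne_zero hp2 i]
  congr 1
  refine Finset.sum_congr rfl fun i _ ↦ ?_
  have h0 := norm_cyclotomicUnit_factor_ne_zero hp2 i
  rw [norm_stdAddChar_add_neg (two_mul_four_pow_ne_zero hp2 i)] at h0 ⊢
  rw [Real.log_div (fun h ↦ h0 (by rw [h, zero_div])) (fun h ↦ h0 (by rw [h, div_zero])),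
    show (4 : ZMod p) * 4 ^ i = 2 ^ (2 * i + 2) by rw [pow_add, pow_mul]; norm_num; ring,
    show (2 : ZMod p) * 4 ^ i = 2 ^ (2 * i + 1) by rw [pow_add, pow_mul]; norm_num; ring]

variable {K : Type*} [Field K] [NumberField K]

theorem abs_log_norm_cyclotomicUnit {g : ℕ} (hg : p = 4 * g + 1) (hg2 : Odd g)
    (h2 : orderOf (2 : ZMod p) = p - 1) {α : K} (hα : α ^ 2 = p)
    (hdeg : Module.finrank ℚ K = 2) {ε : (𝓞 K)ˣ}
    (hfund : ∀ u : (𝓞 K)ˣ, ∃ n : ℤ, u = ε ^ n ∨ u = -ε ^ n) (φ : K →+* ℂ) :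
    |Real.log ‖cyclotomicUnit p g‖| = classNumber K * |Real.log ‖φ ε‖| := by
  have hc : (p : ℤ) = 4 * (g : ℤ) + 1 := by lia
  obtain ⟨e, -⟩ := exists_algEquiv_ringOfIntegers Fact.out hc hα hdeg
  have hdisc : discr K = p := by rw [discr_eq_of_algEquiv e, hc]
  have h := abs_sum_log_eq_sqrt_mul (by lia)
    (tendsto_LSeries_quadraticChar hc (mod_cast hg2) e hdeg)
  have hsqrt : Real.sqrt p ≠ 0 := by
    have := (Fact.out : p.Prime).pos
    positivity
  rw [sum_quadraticChar_mul_log_eq hg h2, dedekindZeta_residue_eq Fact.out hα hdeg hdisc hfund φ,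
    abs_mul, abs_two, abs_of_nonneg (a := _ / Real.sqrt p) (by positivity), mul_div_cancel₀ _ hsqrt,
    mul_assoc] at h
  exact mul_left_cancel₀ two_ne_zero h

theorem exists_unit_pow_eq_cyclotomicUnit {g : ℕ} (hg : p = 4 * g + 1) (hg2 : Odd g)
    (h2 : orderOf (2 : ZMod p) = p - 1) {α : K} (hα : α ^ 2 = p)
    (hdeg : Module.finrank ℚ K = 2) {ε : (𝓞 K)ˣ}
    (hfund : ∀ u : (𝓞 K)ˣ, ∃ n : ℤ, u = ε ^ n ∨ u = -ε ^ n) (φ : K →+* ℂ) :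
    ∃ u : (𝓞 K)ˣ, (u = ε ∨ u = ε⁻¹) ∧ (cyclotomicUnit p g = φ u ^ classNumber K ∨
      cyclotomicUnit p g = -φ u ^ classNumber K) := by
  have := isTotallyReal_of_sq_eq Fact.out hα hdeg
  have hφ := IsTotallyReal.complexEmbedding_isReal φ
  obtain ⟨y, hy⟩ := Complex.conj_eq_iff_real.mp (star_cyclotomicUnit (p := p) g)
  have hy0 : y ≠ 0 := by
    rintro rfl
    exact cyclotomicUnit_ne_zero (by lia) g hy
  have h := abs_log_norm_cyclotomicUnit hg hg2 h2 hα hdeg hfund φ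
  rw [hy] at h ⊢
  obtain ⟨u, hu, hlog⟩ : ∃ u : (𝓞 K)ˣ, (u = ε ∨ u = ε⁻¹) ∧
      Real.log ‖(y : ℂ)‖ = classNumber K * Real.log ‖φ u‖ := by
    rw [← Nat.abs_cast (classNumber K), ← abs_mul, abs_eq_abs] at h
    rcases h with h | h
    · exact ⟨ε, .inl rfl, by simpa using h⟩
    · refine ⟨ε⁻¹, .inr rfl, ?_⟩
      have : φ ((ε⁻¹ : (𝓞 K)ˣ) : 𝓞 K) = (φ ε)⁻¹ := by simp
      rw [this, norm_inv, Real.log_inv, h]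
      simp
  refine ⟨u, hu, ?_⟩
  have hx0 : φ u ≠ 0 := by simp
  rw [← hφ.coe_embedding_apply] at hlog hx0 ⊢
  set x := hφ.embedding u
  rw [Complex.norm_real, Complex.norm_real, Real.norm_eq_abs, Real.norm_eq_abs, ← Real.log_pow]
    at hlog
  have hx0' : x ≠ 0 := by simpa using hx0
  have := Real.log_injOn_pos (abs_pos.mpr hy0) (by positivity : 0 < |x| ^ classNumber K) hlog
  rw [← abs_pow, abs_eq_abs] at this
  exact this.imp (fun h ↦ by rw [h]; push_cast; rfl) fun h ↦ by rw [h]; push_cast; rfl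

end CyclotomicUnit

section ReductionModTwo

open scoped QuadraticAlgebra

theorem IsPrimitiveRoot.exists_ringHom {n : ℕ} (hn : 0 < n) {L F : Type*} [Field L] [CharZero L]
    [CommRing F] [IsDomain F] {z : L} (hz : IsPrimitiveRoot z n) {ζ : F}
    (hζ : IsPrimitiveRoot ζ n) :
    ∃ (A : Type) (_ : CommRing A) (ρ : A) (i : A →+* L) (j : A →+* F),
      Function.Injective i ∧ i ρ = z ∧ j ρ = ζ := by
  have hint : IsIntegral ℤ z := hz.isIntegral hn
  let i : AdjoinRoot (minpoly ℤ z) →+* L :=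
    ((Algebra.adjoin ℤ {z}).val : Algebra.adjoin ℤ {z} →+* L).comp
      (AdjoinRoot.Minpoly.toAdjoin ℤ z : AdjoinRoot (minpoly ℤ z) →+* Algebra.adjoin ℤ {z})
  refine ⟨AdjoinRoot (minpoly ℤ z), inferInstance, AdjoinRoot.root _, i,
    AdjoinRoot.lift (Int.castRingHom F) ζ ?_, ?_, ?_, AdjoinRoot.lift_root _⟩
  · rw [← Polynomial.cyclotomic_eq_minpoly hz hn, Polynomial.eval₂_eq_eval_map,
      Polynomial.map_cyclotomic]
    exact hζ.isRoot_cyclotomic hn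
  · exact Subtype.val_injective.comp (minpoly.ToAdjoin.injective hint)
  · simp [i]

variable {c : ℤ} {F : Type*} [Field F] [CharP F 2]

theorem intCast_eq_zero_or_one_of_charP_two (x : ℤ) :
    (Even x ∧ (x : F) = 0) ∨ (Odd x ∧ (x : F) = 1) := by
  have h2 : (2 : F) = 0 := CharTwo.two_eq_zero
  rcases Int.even_or_odd' x with ⟨k, rfl | rfl⟩
  · exact .inl ⟨even_two_mul k, by push_cast; rw [h2, zero_mul]⟩
  · exact .inr ⟨⟨k, rfl⟩, by push_cast; rw [h2, zero_mul, zero_add]⟩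

theorem QuadraticAlgebra.ringHom_apply {c d : ℤ} {F : Type*} [CommRing F]
    (κ : QuadraticAlgebra ℤ c d →+* F) (z : QuadraticAlgebra ℤ c d) :
    κ z = z.re + z.im * κ ω := by
  have h : z = (z.re : QuadraticAlgebra ℤ c d) + (z.im : QuadraticAlgebra ℤ c d) * ω := by
    ext <;> simp
  conv_lhs => rw [h]
  simp

theorem QuadraticAlgebra.ringHom_omega_sq (hc : Odd c) (κ : QuadraticAlgebra ℤ c 1 →+* F) :
    κ ω ^ 2 + κ ω + 1 = 0 := by
  have h2 : (2 : F) = 0 := CharTwo.two_eq_zero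
  have h : (ω : QuadraticAlgebra ℤ c 1) ^ 2 = (c : QuadraticAlgebra ℤ c 1) + ω := by
    ext <;> simp [sq]
  have h1 := congrArg κ h
  have hc1 : (c : F) = 1 := by
    rcases intCast_eq_zero_or_one_of_charP_two (F := F) c with h | h
    · exact absurd hc (Int.not_odd_iff_even.mpr h.1)
    · exact h.2
  rw [map_pow, map_add, map_intCast, hc1] at h1
  linear_combination h1 + (1 + κ ω) * h2

theorem QuadraticAlgebra.ringHom_eq_zero_iff (hc : Odd c) (κ : QuadraticAlgebra ℤ c 1 →+* F)
    {z : QuadraticAlgebra ℤ c 1} : κ z = 0 ↔ 2 ∣ z := by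
  have h2 : (2 : F) = 0 := CharTwo.two_eq_zero
  have hω := ringHom_omega_sq hc κ
  rw [show (2 : QuadraticAlgebra ℤ c 1) = ((2 : ℤ) : QuadraticAlgebra ℤ c 1) by norm_num,
    intCast_dvd_iff, ← even_iff_two_dvd, ← even_iff_two_dvd, ringHom_apply]
  rcases intCast_eq_zero_or_one_of_charP_two (F := F) z.re with hx | hx <;>
    rcases intCast_eq_zero_or_one_of_charP_two (F := F) z.im with hy | hy <;>
    simp only [hx.2, hy.2, zero_mul, one_mul, zero_add, add_zero, one_ne_zero]
  · simp [hx.1, hy.1]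
  · rw [← Int.not_even_iff_odd] at hy
    simp only [hy.1, and_false, iff_false]
    intro h
    simp [h] at hω
  · rw [← Int.not_even_iff_odd] at hx
    simp [hx.1]
  · rw [← Int.not_even_iff_odd] at hx
    simp only [hx.1, false_and, iff_false]
    intro h
    refine one_ne_zero (α := F) ?_
    linear_combination hω - κ ω * h

theorem QuadraticAlgebra.ringHom_pow_three (hc : Odd c) (κ : QuadraticAlgebra ℤ c 1 →+* F)
    {z : QuadraticAlgebra ℤ c 1} (hz : κ z ≠ 0) : κ z ^ 3 = 1 := by
  have h2 : (2 : F) = 0 := CharTwo.two_eq_zero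
  have hω := ringHom_omega_sq hc κ
  rw [ringHom_apply] at hz ⊢
  rcases intCast_eq_zero_or_one_of_charP_two (F := F) z.re with hx | hx <;>
    rcases intCast_eq_zero_or_one_of_charP_two (F := F) z.im with hy | hy <;>
    rw [hx.2, hy.2] at hz ⊢
  · simp at hz
  · linear_combination (κ ω - 1) * hω
  · simp
  · linear_combination (κ ω + 2) * hω - h2

variable {p : ℕ} [Fact p.Prime]

theorem isPrimitiveRoot_stdAddChar_one : IsPrimitiveRoot (ZMod.stdAddChar (1 : ZMod p) : ℂ) p := by
  have h : orderOf (ZMod.stdAddChar (1 : ZMod p) : ℂ) = p := by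
    refine orderOf_eq_prime ?_ (stdAddChar_ne_one one_ne_zero)
    rw [← AddChar.map_nsmul_eq_pow, nsmul_one, ZMod.natCast_self, AddChar.map_zero_eq_one]
  simpa [h] using IsPrimitiveRoot.orderOf (ZMod.stdAddChar (1 : ZMod p) : ℂ)

theorem stdAddChar_natCast (n : ℕ) :
    (ZMod.stdAddChar (n : ZMod p) : ℂ) = ZMod.stdAddChar (1 : ZMod p) ^ n := by
  rw [← AddChar.map_nsmul_eq_pow, nsmul_one]

theorem gaussSum_quadraticCharComplex_eq {g : ℕ} (hg : p = 4 * g + 1)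
    (h2 : orderOf (2 : ZMod p) = p - 1) :
    gaussSum (quadraticCharComplex p) ZMod.stdAddChar =
      1 + 2 * ∑ k ∈ Finset.range (2 * g), (ZMod.stdAddChar ((4 : ZMod p) ^ k) : ℂ) := by
  have h1 := sum_quadraticChar_mul hg h2 (fun a ↦ (ZMod.stdAddChar a : ℂ))
  have h3 : ∑ a : ZMod p, (ZMod.stdAddChar a : ℂ) = 0 :=
    AddChar.sum_eq_zero_of_ne_one fun h ↦ stdAddChar_ne_one (p := p) one_ne_zero
      (congrArg (fun ψ : AddChar (ZMod p) ℂ ↦ ψ 1) h)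
  rw [ZMod.sum_eq_add_sum_range_pow h2, show p - 1 = 2 * (2 * g) by lia,
    Finset.sum_range_two_mul, AddChar.map_zero_eq_one, Finset.sum_add_distrib] at h3
  rw [Finset.sum_sub_distrib] at h1
  have h4 (k : ℕ) : (4 : ZMod p) ^ k = 2 ^ (2 * k) := by rw [pow_mul]; norm_num
  simp only [h4]
  rw [gaussSum]
  refine h1.trans ?_
  linear_combination -h3

variable {K : Type*} [Field K] [NumberField K]

theorem exists_ringHom_pow_eq {F : Type*} [Field F] [CharP F 2]
    {g : ℕ} (hg : p = 4 * g + 1) (hg2 : Odd g)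
    (h2 : orderOf (2 : ZMod p) = p - 1) {α : K} (hα : α ^ 2 = p)
    (hdeg : Module.finrank ℚ K = 2) {ε : (𝓞 K)ˣ}
    (hfund : ∀ u : (𝓞 K)ˣ, ∃ n : ℤ, u = ε ^ n ∨ u = -ε ^ n)
    {ζ : F} (hζ : IsPrimitiveRoot ζ p) :
    ∃ (κ : 𝓞 K →+* F) (u : (𝓞 K)ˣ),
      (u = ε ∨ u = ε⁻¹) ∧ (ζ + ζ⁻¹) ^ (∑ k ∈ Finset.range g, 4 ^ k) = κ u ^ classNumber K := by
  have hp := (Fact.out : p.Prime)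
  have hc : (p : ℤ) = 4 * (g : ℤ) + 1 := by lia
  obtain ⟨A, _, ρ, i, j, hi, hiρ, hjρ⟩ :=
    (isPrimitiveRoot_stdAddChar_one (p := p)).exists_ringHom hp.pos hζ
  obtain ⟨φ⟩ := (inferInstance : Nonempty (K →+* ℂ))
  set τ := gaussSum (quadraticCharComplex p) ZMod.stdAddChar with hτ
  have hτ2 : τ ^ 2 = p := gaussSum_quadraticCharComplex_sq (by lia)
  obtain ⟨β, hβ, hφβ⟩ : ∃ β : K, β ^ 2 = p ∧ φ β = τ := by
    have : φ α ^ 2 = τ ^ 2 := by rw [hτ2, ← map_pow, hα, map_natCast]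
    rcases sq_eq_sq_iff_eq_or_eq_neg.mp this with h | h
    · exact ⟨α, hα, h⟩
    · exact ⟨-α, by rw [neg_sq, hα], by rw [map_neg, h, neg_neg]⟩
  obtain ⟨e, he⟩ := exists_algEquiv_ringOfIntegers hp hc hβ hdeg
  obtain ⟨u, hu, hcyc⟩ := exists_unit_pow_eq_cyclotomicUnit hg hg2 h2 hα hdeg hfund φ
  have hpow (k : ℕ) : i (ρ ^ 4 ^ k) = ZMod.stdAddChar ((4 : ZMod p) ^ k) := by
    rw [map_pow i, hiρ, ← stdAddChar_natCast]
    push_cast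
    rfl
  set w : A := 1 + ∑ k ∈ Finset.range (2 * g), ρ ^ 4 ^ k with hw
  have hiw : 2 * i w = 1 + τ := by
    rw [hw, map_add, map_one, map_sum, hτ, gaussSum_quadraticCharComplex_eq hg h2]
    simp only [hpow]
    ring
  have hw2 : w * w = (g : ℤ) • (1 : A) + (1 : ℤ) • w := by
    refine hi (mul_left_cancel₀ (by norm_num : (4 : ℂ) ≠ 0) ?_)
    have hpC : (p : ℂ) = 4 * g + 1 := mod_cast congrArg (Nat.cast : ℕ → ℂ) hg
    simp only [map_mul, map_add, map_one, one_smul, zsmul_eq_mul, map_intCast]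
    push_cast
    linear_combination (2 * i w + τ - 1) * hiw + hτ2 + hpC
  let ψ : QuadraticAlgebra ℤ g 1 →ₐ[ℤ] A := QuadraticAlgebra.lift ⟨w, hw2⟩
  let Φ : 𝓞 K →+* A := (ψ : QuadraticAlgebra ℤ g 1 →+* A).comp (e.symm : 𝓞 K →+* _)
  have hψ (z : QuadraticAlgebra ℤ g 1) : i (ψ z) = φ (e z) := by
    refine mul_left_cancel₀ two_ne_zero ?_
    have h1 := congrArg φ (he z)
    have h3 : ψ z = z.re + z.im * w := by
      rw [← AlgHom.coe_toRingHom, QuadraticAlgebra.ringHom_apply]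
      simp [ψ]
    simp only [map_mul, map_add, map_ofNat, map_intCast, map_one, hφβ] at h1
    rw [h1, h3, map_add, map_mul, map_intCast, map_intCast]
    linear_combination (z.im : ℂ) * hiw
  have hΦ (x : 𝓞 K) : i (Φ x) = φ x := by
    have := hψ (e.symm x)
    rwa [e.apply_symm_apply] at this
  have hη : i (∏ k ∈ Finset.range g, (ρ ^ 4 ^ k + (ρ ^ (p - 1)) ^ 4 ^ k)) = cyclotomicUnit p g := by
    rw [map_prod, cyclotomicUnit]
    refine Finset.prod_congr rfl fun k _ ↦ ?_
    rw [map_add, hpow, ← pow_mul, map_pow i, hiρ, ← stdAddChar_natCast]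
    push_cast [hp.one_le]
    simp
  have hF : ∏ k ∈ Finset.range g, (ζ ^ 4 ^ k + (ζ ^ (p - 1)) ^ 4 ^ k) =
      j (Φ u) ^ classNumber K := by
    rw [← hη, ← hΦ] at hcyc
    simp only [← map_pow, ← map_neg, hi.eq_iff] at hcyc
    have hneg : ∏ k ∈ Finset.range g, (ζ ^ 4 ^ k + (ζ ^ (p - 1)) ^ 4 ^ k) =
        j (∏ k ∈ Finset.range g, (ρ ^ 4 ^ k + (ρ ^ (p - 1)) ^ 4 ^ k)) := by
      simp [map_prod, hjρ]
    rw [hneg]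
    rcases hcyc with h | h <;> rw [h]
    · simp
    · rw [map_neg, map_neg, CharTwo.neg_eq, map_pow, map_pow]
  refine ⟨j.comp Φ, u, hu, ?_⟩
  have hinv : ζ ^ (p - 1) = ζ⁻¹ := by
    refine eq_inv_of_mul_eq_one_left ?_
    rw [← pow_succ, Nat.sub_add_cancel hp.one_le, hζ.pow_eq_one]
  rw [hinv] at hF
  rw [RingHom.comp_apply, ← hF, ← Finset.prod_pow_eq_pow_sum]
  refine Finset.prod_congr rfl fun k _ ↦ ?_
  rw [show 4 = 2 ^ 2 from rfl, ← pow_mul, add_pow_char_pow]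

end ReductionModTwo

section Index

theorem three_dvd_div_orderOf_iff {G : Type*} [Monoid G] {x : G} {n : ℕ}
    (hx : x ^ (3 * n) = 1) : 3 ∣ 3 * n / orderOf x ↔ x ^ n = 1 := by
  rw [Nat.dvd_div_iff_mul_dvd (orderOf_dvd_of_pow_eq_one hx), mul_comm (orderOf x),
    Nat.mul_dvd_mul_iff_left three_pos, orderOf_dvd_iff_pow_eq_one]

theorem pow_eq_one_iff_of_pow_prime_eq_one {G : Type*} [Monoid G] {q : ℕ} (hq : q.Prime) {x : G}
    (hx : x ^ q = 1) (n : ℕ) : x ^ n = 1 ↔ x = 1 ∨ q ∣ n := by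
  by_cases h1 : x = 1
  · simp [h1]
  · have := Fact.mk hq
    rw [← orderOf_dvd_iff_pow_eq_one, orderOf_eq_prime hx h1]
    simp [h1]

end Index

/-- If `p ≡ 5 (mod 8)` is prime with `2` a primitive root mod `p`, and
`ζ ∈ F_{2^{p-1}}` is a primitive `p`-th root of unity, then `3` divides
`ind(ζ + ζ⁻¹) = (2^{(p-1)/2} - 1)/ord(ζ + ζ⁻¹)` if and only if
`ε_p ≡ 1 (mod 2O_K)` or `3 ∣ h_p`. -/
theorem stmt_17 (p : ℕ) (hp : p.Prime) (hp8 : p % 8 = 5)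
    (h2p : orderOf (2 : ZMod p) = p - 1)
    (F : Type) [Field F] [Fintype F] (hF : Fintype.card F = 2 ^ (p - 1))
    (ζ : F) (hζ : IsPrimitiveRoot ζ p)
    (K : Type) [Field K] [NumberField K] (α : K) (hα : α ^ 2 = (p : K))
    (hdeg : Module.finrank ℚ K = 2)
    (ε : (𝓞 K)ˣ)
    (hfund : ∀ u : (𝓞 K)ˣ, ∃ n : ℤ, u = ε ^ n ∨ u = -ε ^ n) :
    (3 ∣ (2 ^ ((p - 1) / 2) - 1) / orderOf (ζ + ζ⁻¹)) ↔
      ((ε : 𝓞 K) - 1 ∈ Ideal.span {(2 : 𝓞 K)} ∨ 3 ∣ classNumber K) := by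
  have := Fact.mk hp
  have : CharP F 2 := charP_of_card_eq_prime_pow hF
  obtain ⟨g, hg⟩ : ∃ g, p = 4 * g + 1 := ⟨p / 4, by lia⟩
  have hg2 : Odd g := Nat.odd_iff.mpr (by lia)
  have hgZ : Odd (g : ℤ) := mod_cast hg2
  obtain ⟨e, -⟩ := exists_algEquiv_ringOfIntegers hp (c := g) (by lia) hα hdeg
  obtain ⟨κ, u, hu, hpow⟩ := exists_ringHom_pow_eq hg hg2 h2p hα hdeg hfund hζ
  set κ' : QuadraticAlgebra ℤ g 1 →+* F := κ.comp (e : QuadraticAlgebra ℤ g 1 →+* 𝓞 K)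
  have hκ (x : 𝓞 K) : κ x = κ' (e.symm x) := by simp [κ']
  have hu3 : κ u ^ 3 = 1 := by
    rw [hκ]
    refine QuadraticAlgebra.ringHom_pow_three hgZ κ' ?_
    rw [← hκ]
    exact (u.isUnit.map κ).ne_zero
  have hε : κ u = 1 ↔ (ε : 𝓞 K) - 1 ∈ Ideal.span {(2 : 𝓞 K)} := by
    have hmap (v : (𝓞 K)ˣ) : κ v = 1 ↔ Units.map (κ : 𝓞 K →* F) v = 1 := by
      rw [Units.ext_iff]; rfl
    have huε : κ u = 1 ↔ κ ε = 1 := by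
      rcases hu with rfl | rfl
      · rfl
      · rw [hmap, hmap, map_inv, inv_eq_one]
    rw [huε, ← sub_eq_zero, ← map_one κ, ← map_sub, hκ, QuadraticAlgebra.ringHom_eq_zero_iff hgZ,
      Ideal.mem_span_singleton, ← map_dvd_iff e, e.apply_symm_apply,
      show e 2 = 2 from map_ofNat e 2]
  have hN : 2 ^ ((p - 1) / 2) - 1 = 3 * ∑ k ∈ Finset.range g, 4 ^ k := by
    have h := geom_sum_mul_add 3 g
    rw [show (p - 1) / 2 = 2 * g by lia, pow_mul]
    norm_num at h ⊢
    lia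
  rw [hN, three_dvd_div_orderOf_iff, hpow, pow_eq_one_iff_of_pow_prime_eq_one Nat.prime_three hu3,
    hε]
  rw [mul_comm, pow_mul, hpow, ← pow_mul, mul_comm, pow_mul, hu3, one_pow]
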